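/- arXiv:1703.02251 — 5 statements merged into one kernel-verified Lean document; each statement's English description precedes it below -/
import Mathlib

section
/- For generic u ∈ ℂ^{n+1}, the set {θ ∈ ℂ : θ ≠ 0, f(θ) ≠ 0, and (Σ_{i=0}^n i·u_i)·f(θ) = (Σ_{i=0}^n u_i)·θ·f′(θ)} is finite with cardinality equal to the number of distinct complex roots of f. (The ML degree of the scaled rational normal curve C_n^c equals the number of distinct roots of c_0 + c_1θ + ⋯ + c_nθ^n.) -/
open scoped BigOperators

/-- The polynomial `f = c₀ + c₁ x + ⋯ + c_n xⁿ` of a scaled rational normal curve. -/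
noncomputable def rncF {n : ℕ} (c : Fin (n + 1) → ℂ) : Polynomial ℂ :=
  ∑ i, Polynomial.C (c i) * Polynomial.X ^ (i : ℕ)

open Polynomial in
/-- Dividing `f` and `f'` by their common factor leaves a monic polynomial with the same roots as
`f`, all simple, and a polynomial that vanishes at none of these roots. -/
theorem exists_reduced_logDeriv (f : ℂ[X]) (hf : 1 ≤ f.natDegree) :
    ∃ g P Q : ℂ[X], f = g * P ∧ derivative f = g * Q ∧ P.Monic ∧
      P.natDegree = f.roots.toFinset.card ∧ Q.natDegree + 1 ≤ P.natDegree ∧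
      (∀ θ, P.eval θ = 0 ↔ f.eval θ = 0) ∧ ∀ θ, P.eval θ = 0 → Q.eval θ ≠ 0 := by
  classical
  have hf0 : f ≠ 0 := by rintro rfl; simp at hf
  have hd0 : derivative f ≠ 0 := fun h => by
    have := derivative_eq_zero.1 h
    omega
  set P : ℂ[X] := ∏ α ∈ f.roots.toFinset, (X - C α) with hP
  have hPm : P.Monic := monic_prod_of_monic _ _ fun α _ => monic_X_sub_C α
  have hPr : P.roots = f.roots.dedup := by
    rw [hP, roots_prod_X_sub_C, Multiset.toFinset_val]
  have hPdeg : P.natDegree = f.roots.toFinset.card := by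
    rw [hP, natDegree_prod_of_monic _ _ fun α _ => monic_X_sub_C α]
    simp
  have hProot : ∀ θ, P.eval θ = 0 ↔ f.eval θ = 0 := fun θ => by
    rw [← IsRoot.def, ← mem_roots hPm.ne_zero, hPr, Multiset.mem_dedup, mem_roots hf0, IsRoot.def]
  obtain ⟨g, hg⟩ : P ∣ f := by
    rw [(IsAlgClosed.splits P).dvd_iff_roots_le_roots hPm.ne_zero hf0, hPr]
    exact Multiset.dedup_le _
  rw [mul_comm] at hg
  have hg0 : g ≠ 0 := by rintro rfl; simp [hf0] at hg
  have hmul : ∀ θ, f.eval θ = 0 →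
      (derivative f).rootMultiplicity θ = g.rootMultiplicity θ := fun θ h => by
    have h1 : θ ∈ f.roots := (mem_roots hf0).2 h
    have h2 : P.rootMultiplicity θ = 1 := by
      rw [← count_roots, hPr]
      exact Multiset.count_eq_one_of_mem (Multiset.nodup_dedup _) (Multiset.mem_dedup.2 h1)
    have h3 : f.rootMultiplicity θ = g.rootMultiplicity θ + P.rootMultiplicity θ := by
      conv_lhs => rw [hg]
      exact rootMultiplicity_mul (mul_ne_zero hg0 hPm.ne_zero)
    rw [derivative_rootMultiplicity_of_root h]
    omega
  obtain ⟨Q, hQ⟩ : g ∣ derivative f := by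
    rw [(IsAlgClosed.splits g).dvd_iff_roots_le_roots hg0 hd0, Multiset.le_iff_count]
    intro θ
    rw [count_roots, count_roots]
    by_cases h : f.eval θ = 0
    · rw [hmul θ h]
    · rw [rootMultiplicity_eq_zero]
      · exact Nat.zero_le _
      · intro h'
        apply h
        rw [hg, eval_mul, h'.eq_zero, zero_mul]
  have hQ0 : Q ≠ 0 := by rintro rfl; simp [hd0] at hQ
  refine ⟨g, P, Q, hg, hQ, hPm, hPdeg, ?_, hProot, ?_⟩
  · have h1 : f.natDegree = g.natDegree + P.natDegree := by
      conv_lhs => rw [hg]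
      exact natDegree_mul hg0 hPm.ne_zero
    have h2 : (derivative f).natDegree = g.natDegree + Q.natDegree := by
      rw [hQ, natDegree_mul hg0 hQ0]
    have h3 := natDegree_derivative_lt (p := f) (by omega)
    omega
  · intro θ h h'
    have h1 := hmul θ ((hProot θ).1 h)
    rw [hQ, rootMultiplicity_mul (mul_ne_zero hg0 hQ0)] at h1
    have h2 := (rootMultiplicity_pos hQ0).2 h'
    omega

open Polynomial in
/-- A member `aP - bXQ` of the pencil spanned by `P` and `XQ` has `deg P` distinct roots, unless
it loses degree or vanishes at a root of the Wronskian of the pencil. -/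
theorem card_roots_pencil {P Q : ℂ[X]} (hP : P.Monic) (hdeg : Q.natDegree + 1 ≤ P.natDegree)
    {a b : ℂ} (hb : b ≠ 0) (htop : a - b * (X * Q).coeff P.natDegree ≠ 0)
    (hW : ∀ w, (P * derivative (X * Q) - derivative P * (X * Q)).eval w = 0 →
      a * P.eval w - b * (w * Q.eval w) ≠ 0) :
    C a * P - C b * (X * Q) ≠ 0 ∧
      (C a * P - C b * (X * Q)).roots.toFinset.card = P.natDegree := by
  classical
  set h : ℂ[X] := C a * P - C b * (X * Q) with hh
  have hcoeff : h.coeff P.natDegree = a - b * (X * Q).coeff P.natDegree := by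
    simp only [hh, coeff_sub, coeff_C_mul, hP.coeff_natDegree, mul_one]
  have h0 : h ≠ 0 := by
    intro h0
    rw [h0, coeff_zero] at hcoeff
    exact htop hcoeff.symm
  have hXQ : (X * Q).natDegree ≤ P.natDegree := by
    refine natDegree_mul_le.trans ?_
    rw [natDegree_X]
    omega
  have hnat : h.natDegree = P.natDegree := by
    refine le_antisymm ?_ (le_natDegree_of_ne_zero (hcoeff ▸ htop))
    exact (natDegree_sub_le _ _).trans
      (max_le (natDegree_C_mul_le _ _) ((natDegree_C_mul_le _ _).trans hXQ))
  have hnodup : h.roots.Nodup := by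
    rw [Multiset.nodup_iff_count_le_one]
    intro w
    rw [count_roots]
    by_contra hlt
    obtain ⟨hr, hr'⟩ := (one_lt_rootMultiplicity_iff_isRoot h0).1 (not_le.1 hlt)
    have e1 : a * P.eval w - b * (w * Q.eval w) = 0 := by
      simpa [hh] using hr.eq_zero
    have e2 : a * (derivative P).eval w - b * (derivative (X * Q)).eval w = 0 := by
      have := hr'.eq_zero
      rw [hh, derivative_sub, derivative_C_mul, derivative_C_mul] at this
      simpa only [eval_sub, eval_mul, eval_C] using this
    refine hW w ?_ e1
    rw [eval_sub, eval_mul, eval_mul, eval_mul, eval_X]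
    refine mul_left_cancel₀ hb ?_
    linear_combination (derivative P).eval w * e1 - P.eval w * e2
  refine ⟨h0, ?_⟩
  rw [Multiset.toFinset_card_of_nodup hnodup, ← hnat]
  exact (IsAlgClosed.splits h).natDegree_eq_card_roots.symm

/-- The linear form `α ∑ i·u_i - β ∑ u_i` in the data `u`. -/
noncomputable def dataForm (n : ℕ) (α β : ℂ) : MvPolynomial (Fin (n + 1)) ℂ :=
  MvPolynomial.C α * ∑ i : Fin (n + 1), MvPolynomial.C ((i : ℕ) : ℂ) * MvPolynomial.X i -
    MvPolynomial.C β * ∑ i : Fin (n + 1), MvPolynomial.X i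

theorem eval_dataForm (n : ℕ) (α β : ℂ) (u : Fin (n + 1) → ℂ) :
    MvPolynomial.eval u (dataForm n α β) =
      α * ∑ i : Fin (n + 1), ((i : ℕ) : ℂ) * u i - β * ∑ i, u i := by
  simp [dataForm]

theorem dataForm_ne_zero {n : ℕ} (hn : 1 ≤ n) {α β : ℂ} (h : α ≠ 0 ∨ β ≠ 0) :
    dataForm n α β ≠ 0 := by
  intro h0
  have key (j : Fin (n + 1)) : α * ((j : ℕ) : ℂ) - β = 0 := by
    have := eval_dataForm n α β (Pi.single j 1)
    rw [h0] at this
    simpa [Pi.single_apply] using this.symm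
  have e0 := key 0
  have e1 := key ⟨1, by omega⟩
  simp only [Fin.val_zero, Nat.cast_zero, mul_zero, zero_sub, neg_eq_zero] at e0
  subst e0
  simp at e1
  simp [e1] at h

theorem coeff_rncF {n : ℕ} (c : Fin (n + 1) → ℂ) (j : Fin (n + 1)) :
    (rncF c).coeff j = c j := by
  simp [rncF, Polynomial.coeff_X_pow, Fin.val_inj]

/-- The ML degree of the scaled rational normal curve `C_n^c` equals the number of
distinct complex roots of `f = c₀ + c₁ θ + ⋯ + c_n θⁿ`: for generic `u`, the set of
`θ ∈ ℂ*` with `f(θ) ≠ 0` satisfying `(∑ i, i·u_i) f(θ) = (∑ i, u_i) θ f'(θ)` is finite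
of cardinality the number of distinct roots of `f`. -/
theorem ml_degree_rational_normal_curve
    (n : ℕ) (hn : 1 ≤ n) (c : Fin (n + 1) → ℂ) (hc : ∀ i, c i ≠ 0) :
    ∃ G : MvPolynomial (Fin (n + 1)) ℂ, G ≠ 0 ∧
      ∀ u : Fin (n + 1) → ℂ, MvPolynomial.eval u G ≠ 0 →
        {θ : ℂ | θ ≠ 0 ∧ (rncF c).eval θ ≠ 0 ∧
            (∑ i : Fin (n + 1), ((i : ℕ) : ℂ) * u i) * (rncF c).eval θ =
              (∑ i, u i) * (θ * ((rncF c).derivative.eval θ))}.Finite ∧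
        {θ : ℂ | θ ≠ 0 ∧ (rncF c).eval θ ≠ 0 ∧
            (∑ i : Fin (n + 1), ((i : ℕ) : ℂ) * u i) * (rncF c).eval θ =
              (∑ i, u i) * (θ * ((rncF c).derivative.eval θ))}.ncard =
          (rncF c).roots.toFinset.card := by
  classical
  have hf : 1 ≤ (rncF c).natDegree := by
    refine hn.trans (Polynomial.le_natDegree_of_ne_zero ?_)
    have := coeff_rncF c (Fin.last n)
    rw [Fin.val_last] at this
    exact this ▸ hc _
  have hf0 : (rncF c).eval 0 ≠ 0 := by
    have := coeff_rncF c 0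
    rw [Fin.val_zero, Polynomial.coeff_zero_eq_eval_zero] at this
    exact this ▸ hc _
  have hf1 : (rncF c).derivative.eval 0 ≠ 0 := by
    have := coeff_rncF c ⟨1, by omega⟩
    rw [← Polynomial.coeff_zero_eq_eval_zero, Polynomial.coeff_derivative]
    simpa [this] using hc _
  obtain ⟨g, P, Q, hgP, hgQ, hPm, hPdeg, hdeg, hroot, hPQ⟩ := exists_reduced_logDeriv _ hf
  have hP0 : P.eval 0 ≠ 0 := fun h => hf0 ((hroot 0).1 h)
  have hQ0 : Q.eval 0 ≠ 0 := fun h => hf1 (by rw [hgQ, Polynomial.eval_mul, h, mul_zero])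
  set W := P * (Polynomial.X * Q).derivative - P.derivative * (Polynomial.X * Q) with hWdef
  have hW : W ≠ 0 := by
    intro h
    have : W.eval 0 = P.eval 0 * Q.eval 0 := by simp [hWdef]
    rw [h, Polynomial.eval_zero] at this
    exact mul_ne_zero hP0 hQ0 this.symm
  refine ⟨dataForm n 1 0 * dataForm n 0 1 *
    dataForm n 1 ((Polynomial.X * Q).coeff P.natDegree) *
    ∏ w ∈ W.roots.toFinset, dataForm n (P.eval w) (w * Q.eval w), ?_, ?_⟩
  · refine mul_ne_zero (mul_ne_zero (mul_ne_zero ?_ ?_) ?_) (Finset.prod_ne_zero_iff.2 ?_)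
    · exact dataForm_ne_zero hn (Or.inl one_ne_zero)
    · exact dataForm_ne_zero hn (Or.inr one_ne_zero)
    · exact dataForm_ne_zero hn (Or.inl one_ne_zero)
    · intro w _
      refine dataForm_ne_zero hn (or_iff_not_imp_left.2 fun h => ?_)
      rw [not_not] at h
      refine mul_ne_zero ?_ (hPQ w h)
      rintro rfl
      exact hP0 h
  intro u hu
  simp only [map_mul, map_prod, eval_dataForm, ne_eq, mul_eq_zero, not_or,
    Finset.prod_eq_zero_iff, not_exists, not_and] at hu
  set a : ℂ := ∑ i : Fin (n + 1), ((i : ℕ) : ℂ) * u i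
  set b : ℂ := ∑ i, u i
  obtain ⟨⟨⟨ha, hb⟩, htop⟩, hw⟩ := hu
  replace ha : a ≠ 0 := by simpa using ha
  replace hb : b ≠ 0 := by simpa using hb
  obtain ⟨h0, hcard⟩ := card_roots_pencil (a := a) (b := b) hPm hdeg hb
    (fun h => htop (by linear_combination h)) (fun w hw0 h => hw w
      (Multiset.mem_toFinset.2 ((Polynomial.mem_roots hW).2 hw0)) (by linear_combination h))
  have hset : {θ : ℂ | θ ≠ 0 ∧ (rncF c).eval θ ≠ 0 ∧
      a * (rncF c).eval θ = b * (θ * ((rncF c).derivative.eval θ))} =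
      ((Polynomial.C a * P - Polynomial.C b * (Polynomial.X * Q)).roots.toFinset : Set ℂ) := by
    ext θ
    simp only [Set.mem_ofPred_eq, Finset.mem_coe, Multiset.mem_toFinset, Polynomial.mem_roots h0,
      Polynomial.IsRoot.def, Polynomial.eval_sub, Polynomial.eval_mul, Polynomial.eval_C,
      Polynomial.eval_X]
    rw [hgQ, Polynomial.eval_mul]
    have hfθ : (rncF c).eval θ = g.eval θ * P.eval θ := by
      conv_lhs => rw [hgP]
      exact Polynomial.eval_mul
    constructor
    · rintro ⟨-, hne, heq⟩
      rw [hfθ] at hne heq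
      exact mul_left_cancel₀ (left_ne_zero_of_mul hne) (by linear_combination heq)
    · intro h
      have hθ : θ ≠ 0 := by
        rintro rfl
        exact mul_ne_zero ha hP0 (by linear_combination h)
      have hPθ : P.eval θ ≠ 0 := fun hz =>
        mul_ne_zero hb (mul_ne_zero hθ (hPQ θ hz)) (by linear_combination a * hz - h)
      refine ⟨hθ, mt (hroot θ).2 hPθ, ?_⟩
      rw [hfθ]
      linear_combination g.eval θ * h
  rw [hset]
  exact ⟨Finset.finite_toSet _, by rw [Set.ncard_coe_finset, hcard, hPdeg]⟩
end

section
/- For all positive integers n_1 and n_2, the polynomial (1 + x + ⋯ + x^{n_1})·(1 + x + ⋯ + x^{n_2}) ∈ ℂ[x] has exactly n_1 + n_2 + 1 − gcd(n_1+1, n_2+1) distinct complex roots. -/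
open scoped BigOperators
open Polynomial

/-- The roots of `1 + x + ⋯ + x^(m-1)` are the `m`-th roots of unity other than `1`. -/
theorem eval_geom_sum_eq_zero_iff {R : Type*} [CommRing R] [IsDomain R] [CharZero R]
    {m : ℕ} (hm : 0 < m) (x : R) :
    (∑ i ∈ Finset.range m, (X : R[X]) ^ i).eval x = 0 ↔ x ^ m = 1 ∧ x ≠ 1 := by
  rw [eval_geom_sum]
  rcases eq_or_ne x 1 with rfl | hx
  · simp [hm.ne']
  · rw [← sub_eq_zero (a := x ^ m), ← geom_sum_mul x m, mul_eq_zero]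
    simp [sub_ne_zero.mpr hx, hx]

theorem roots_geom_sum_toFinset {R : Type*} [CommRing R] [IsDomain R] [CharZero R]
    [DecidableEq R] {m : ℕ} (hm : 0 < m) :
    (∑ i ∈ Finset.range m, (X : R[X]) ^ i).roots.toFinset = (nthRootsFinset m (1 : R)).erase 1 := by
  have h0 : (∑ i ∈ Finset.range m, (X : R[X]) ^ i) ≠ 0 := fun h => by
    have := (eval_geom_sum_eq_zero_iff hm (1 : R)).mp (by simp [h])
    exact this.2 rfl
  ext x
  rw [Multiset.mem_toFinset, mem_roots h0, IsRoot, eval_geom_sum_eq_zero_iff hm,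
    Finset.mem_erase, Polynomial.mem_nthRootsFinset hm, and_comm]

theorem nthRootsFinset_one_inter {R : Type*} [CommRing R] [IsDomain R] [DecidableEq R]
    {m n : ℕ} (hm : 0 < m) (hn : 0 < n) :
    nthRootsFinset m (1 : R) ∩ nthRootsFinset n 1 = nthRootsFinset (m.gcd n) 1 := by
  ext x
  rw [Finset.mem_inter, Polynomial.mem_nthRootsFinset hm, Polynomial.mem_nthRootsFinset hn,
    Polynomial.mem_nthRootsFinset (Nat.gcd_pos_of_pos_left n hm), pow_gcd_eq_one]

theorem card_nthRootsFinset_one_erase_one {m : ℕ} (hm : 0 < m) :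
    ((nthRootsFinset m (1 : ℂ)).erase 1).card = m - 1 := by
  rw [Finset.card_erase_of_mem (one_mem_nthRootsFinset hm),
    (Complex.isPrimitiveRoot_exp m hm.ne').card_nthRootsFinset]

/-- The polynomial `(1 + x + ⋯ + x^{n₁})(1 + x + ⋯ + x^{n₂})` has exactly
`n₁ + n₂ + 1 - gcd (n₁+1) (n₂+1)` distinct complex roots: the ML degree of the
Hirzebruch surface `H_{n₁,n₂}`. -/
theorem distinct_roots_hirzebruch (n₁ n₂ : ℕ) (h₁ : 0 < n₁) (h₂ : 0 < n₂) :
    ((∑ i ∈ Finset.range (n₁ + 1), (X : Polynomial ℂ) ^ i) *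
        (∑ i ∈ Finset.range (n₂ + 1), (X : Polynomial ℂ) ^ i)).roots.toFinset.card =
      n₁ + n₂ + 1 - Nat.gcd (n₁ + 1) (n₂ + 1) := by
  have hg : 0 < Nat.gcd (n₁ + 1) (n₂ + 1) := Nat.gcd_pos_of_pos_left _ n₁.add_one_pos
  have hne (n : ℕ) : (∑ i ∈ Finset.range (n + 1), (X : ℂ[X]) ^ i) ≠ 0 :=
    (Monic.geom_sum' monic_X (by simp) n.succ_ne_zero).ne_zero
  have hcard := Finset.card_union_add_card_inter
    ((nthRootsFinset (n₁ + 1) (1 : ℂ)).erase 1) ((nthRootsFinset (n₂ + 1) (1 : ℂ)).erase 1)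
  rw [Finset.erase_inter, Finset.inter_erase, Finset.erase_idem,
    nthRootsFinset_one_inter n₁.add_one_pos n₂.add_one_pos,
    card_nthRootsFinset_one_erase_one hg, card_nthRootsFinset_one_erase_one n₁.add_one_pos,
    card_nthRootsFinset_one_erase_one n₂.add_one_pos] at hcard
  rw [roots_mul (mul_ne_zero (hne n₁) (hne n₂)), Multiset.toFinset_add,
    roots_geom_sum_toFinset n₁.add_one_pos, roots_geom_sum_toFinset n₂.add_one_pos]
  omega
end

section
/- Suppose 1 ≤ k ≤ d−1 and let A be the Veronese matrix of the context with trivial scaling c = (1,1,…,1). Then there is a nonzero polynomial G ∈ ℂ[u] such that for every u ∈ ℂ^n with G(u) ≠ 0 the likelihood system for (A,(1,…,1),u) has exactly k^{d−1} solutions. (The ML degree of the Veronese Ver(d−1,k) with trivial scaling equals its degree k^{d−1} whenever k ≤ d−1.) -/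
open scoped BigOperators

/-- The likelihood system for a matrix `A`, scaling `c` and data `u`. -/
def mlSolutions {κ ι : Type*} [Fintype κ] [Fintype ι] (A : κ → ι → ℤ)
    (c u : ι → ℂ) : Set (ι → ℂ) :=
  {p | (∀ j, p j ≠ 0) ∧
    (∀ v : ι → ℤ, (∀ i, ∑ j, A i j * v j = 0) → (∑ j, v j = 0) →
      (∏ j, p j ^ (max (v j) 0).toNat) = (∏ j, p j ^ (max (-v j) 0).toNat)) ∧
    (∑ j, c j * p j = 1) ∧
    (∀ i, (∑ j, u j) * (∑ j, (A i j : ℂ) * (c j * p j)) = ∑ j, (A i j : ℂ) * u j)}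

/-- Column indices of the Veronese `Ver(d-1,k)`: exponent vectors `α ∈ ℕ^{d-1}`
with `α₁ + ⋯ + α_{d-1} ≤ k`. -/
abbrev VerIndex (d k : ℕ) : Type :=
  {α : Fin (d - 1) → Fin (k + 1) // ∑ i, (α i : ℕ) ≤ k}

/-- The matrix of the Veronese `Ver(d-1,k)`. -/
def verA (d k : ℕ) : Fin (d - 1) → VerIndex d k → ℤ :=
  fun i α => ((α.1 i : ℕ) : ℤ)

open Polynomial in
/-- A Bézout relation for a separable polynomial, with denominators cleared. -/
theorem exists_mul_add_mul_derivative_eq_C {A : Type*} [CommRing A] [IsDomain A] (K : Type*)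
    [Field K] [Algebra A K] [IsFractionRing A K] (P : A[X])
    (hP : (P.map (algebraMap A K)).Separable) :
    ∃ c : A, c ≠ 0 ∧ ∃ U V : A[X], U * P + V * derivative P = C c := by
  obtain ⟨U, V, hUV⟩ := hP
  obtain ⟨b, hb, h1⟩ := IsLocalization.integerNormalization_spec (nonZeroDivisors A) U
  obtain ⟨b', hb', h2⟩ := IsLocalization.integerNormalization_spec (nonZeroDivisors A) V
  set U' := IsLocalization.integerNormalization (nonZeroDivisors A) U
  set V' := IsLocalization.integerNormalization (nonZeroDivisors A) V
  refine ⟨b * b', mul_ne_zero (nonZeroDivisors.ne_zero hb) (nonZeroDivisors.ne_zero hb'),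
    C b' * U', C b * V', ?_⟩
  apply Polynomial.map_injective _ (IsFractionRing.injective A K)
  rw [← algebraMap_smul K, smul_eq_C_mul] at h1 h2
  rw [derivative_map] at hUV
  simp only [Polynomial.map_add, Polynomial.map_mul, h1, h2, map_C, map_mul]
  linear_combination (C (algebraMap A K b) * C (algebraMap A K b')) * hUV

open Polynomial IntermediateField in
/-- A finite extension of domains in characteristic zero is generically generated by one element. -/
theorem exists_primitive_element_generic (A R : Type*) [CommRing A] [IsDomain A] [CharZero A]
    [IsIntegrallyClosed A]
    [CommRing R] [IsDomain R] [Algebra A R] [Module.Finite A R] [FaithfulSMul A R] :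
    ∃ θ : R, (minpoly A θ).natDegree = Module.finrank A R ∧
      (∃ c : A, c ≠ 0 ∧
        ∃ U V : A[X], U * minpoly A θ + V * derivative (minpoly A θ) = C c) ∧
      ∃ a : A, a ≠ 0 ∧ ∀ r : R, ∃ Q : A[X], aeval θ Q = a • r := by
  let K := FractionRing A
  let L := FractionRing R
  let _ : Algebra K L := FractionRing.liftAlgebra A L
  have hfin : Module.finrank K L = Module.finrank A R :=
    congrArg Cardinal.toNat (Algebra.IsAlgebraic.rank_fractionRing A R)
  have : CharZero K := charZero_of_injective_algebraMap (IsFractionRing.injective A K)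
  have : Module.Finite K L := inferInstance
  obtain ⟨θ', hθ'⟩ := Field.exists_primitive_element K L
  obtain ⟨θ, s, hs⟩ := IsLocalization.exists_mk'_eq
    (Algebra.algebraMapSubmonoid R (nonZeroDivisors A)) θ'
  obtain ⟨s, b, hb, rfl⟩ := s
  have hb0 : b ≠ 0 := nonZeroDivisors.ne_zero hb
  have hθ : θ' * algebraMap A L b = algebraMap R L θ := by
    rw [IsLocalization.mk'_eq_iff_eq_mul] at hs
    rw [hs, IsScalarTower.algebraMap_apply A R L]
  have htop : K⟮algebraMap R L θ⟯ = ⊤ := by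
    rw [eq_top_iff, ← hθ', adjoin_simple_le_iff]
    have h1 : algebraMap R L θ ∈ K⟮algebraMap R L θ⟯ := mem_adjoin_simple_self _ _
    have h2 : algebraMap A L b ∈ K⟮algebraMap R L θ⟯ := by
      rw [IsScalarTower.algebraMap_apply A K L]
      exact IntermediateField.algebraMap_mem _ _
    have h3 : algebraMap A L b ≠ 0 := by
      rw [IsScalarTower.algebraMap_apply A K L]
      simpa using hb0
    rw [eq_div_of_mul_eq h3 hθ]
    exact div_mem h1 h2
  have hint : IsIntegral A θ := Algebra.IsIntegral.isIntegral θ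
  have hmin : minpoly K (algebraMap R L θ) = (minpoly A θ).map (algebraMap A K) :=
    minpoly.isIntegrallyClosed_eq_field_fractions K L hint
  have hintK : IsIntegral K (algebraMap R L θ) := Algebra.IsIntegral.isIntegral _
  refine ⟨θ, ?_, ?_, ?_⟩
  · rw [← hfin, ← (minpoly.monic hint).natDegree_map (algebraMap A K), ← hmin,
      ← adjoin.finrank hintK, htop, finrank_top']
  · apply exists_mul_add_mul_derivative_eq_C K
    rw [← hmin]
    exact Algebra.IsSeparable.isSeparable K _
  · have key : ∀ r : R, ∃ a : A, a ≠ 0 ∧ ∃ Q : A[X], aeval θ Q = a • r := by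
      intro r
      have hr : algebraMap R L r ∈ K⟮algebraMap R L θ⟯ := htop ▸ mem_top
      rw [← mem_toSubalgebra, adjoin_simple_toSubalgebra_of_isAlgebraic hintK.isAlgebraic,
        Algebra.adjoin_singleton_eq_range_aeval] at hr
      obtain ⟨q, hq⟩ := hr
      obtain ⟨a, ha, h⟩ := IsLocalization.integerNormalization_spec (nonZeroDivisors A) q
      refine ⟨a, nonZeroDivisors.ne_zero ha,
        IsLocalization.integerNormalization (nonZeroDivisors A) q, ?_⟩
      apply IsFractionRing.injective R L
      rw [← aeval_algebraMap_apply, ← aeval_map_algebraMap K, h, ← algebraMap_smul K, map_smul,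
        Algebra.smul_def a, map_mul, ← IsScalarTower.algebraMap_apply, Algebra.smul_def,
        ← IsScalarTower.algebraMap_apply]
      congr 1
    choose a ha Q hQ using key
    obtain ⟨S, hS⟩ := Module.Finite.fg_top (R := A) (M := R)
    classical
    refine ⟨∏ s ∈ S, a s, Finset.prod_ne_zero_iff.mpr fun s _ => ha s, fun r => ?_⟩
    have hr : r ∈ Submodule.span A (S : Set R) := hS ▸ Submodule.mem_top
    induction hr using Submodule.span_induction with
    | mem x hx =>
      refine ⟨C (∏ s ∈ S.erase x, a s) * Q x, ?_⟩
      rw [map_mul, aeval_C, hQ, ← Algebra.smul_def, smul_smul, Finset.prod_erase_mul _ _ hx]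
    | zero => exact ⟨0, by simp⟩
    | add x y _ _ hx hy =>
      obtain ⟨P, hP⟩ := hx
      obtain ⟨Q, hQ⟩ := hy
      exact ⟨P + Q, by simp [hP, hQ]⟩
    | smul c x _ hx =>
      obtain ⟨P, hP⟩ := hx
      exact ⟨C c * P, by rw [map_mul, aeval_C, hP, ← Algebra.smul_def, smul_comm]⟩

open Polynomial in
theorem exists_generic_card_fiber (A R Ω : Type*) [CommRing A] [IsDomain A] [CharZero A]
    [IsIntegrallyClosed A]
    [CommRing R] [IsDomain R] [Algebra A R] [Module.Finite A R] [FaithfulSMul A R]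
    [Field Ω] [IsAlgClosed Ω] :
    ∃ a : A, a ≠ 0 ∧ ∀ ψ : A →+* Ω, ψ a ≠ 0 →
      Finite {χ : R →+* Ω // χ.comp (algebraMap A R) = ψ} ∧
      Nat.card {χ : R →+* Ω // χ.comp (algebraMap A R) = ψ} = Module.finrank A R := by
  obtain ⟨θ, hdeg, ⟨c, hc, U, V, hUV⟩, a, ha, hQ⟩ := exists_primitive_element_generic A R
  choose Q hQ using hQ
  have hint : IsIntegral A θ := Algebra.IsIntegral.isIntegral θ
  have hmonic := minpoly.monic hint
  refine ⟨a * c, mul_ne_zero ha hc, fun ψ hψ => ?_⟩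
  rw [map_mul, mul_ne_zero_iff] at hψ
  obtain ⟨hψa, hψc⟩ := hψ
  set P := (minpoly A θ).map ψ with hP
  have hPmonic : P.Monic := hmonic.map ψ
  have hsep : P.Separable := by
    refine ⟨C (ψ c)⁻¹ * U.map ψ, C (ψ c)⁻¹ * V.map ψ, ?_⟩
    have h := congrArg (Polynomial.map ψ) hUV
    simp only [Polynomial.map_add, Polynomial.map_mul, map_C, ← derivative_map] at h
    rw [mul_assoc, mul_assoc, ← mul_add, h, ← C_mul, inv_mul_cancel₀ hψc, C_1]
  have hcard : Nat.card (P.rootSet Ω) = Module.finrank A R := by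
    rw [Nat.card_eq_fintype_card, card_rootSet_eq_natDegree hsep (IsAlgClosed.splits _), hP,
      hmonic.natDegree_map, hdeg]
  have hχ : ∀ (χ : R →+* Ω), χ.comp (algebraMap A R) = ψ → ∀ q : A[X],
      χ (aeval θ q) = eval₂ ψ (χ θ) q := by
    rintro χ rfl q
    rw [aeval_def, hom_eval₂]
  have hwd : ∀ t ∈ P.rootSet Ω, ∀ q q' : A[X], aeval θ q = aeval θ q' →
      eval₂ ψ t q = eval₂ ψ t q' := by
    intro t ht q q' h
    rw [← sub_eq_zero, ← map_sub, minpoly.isIntegrallyClosed_dvd_iff hint] at h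
    obtain ⟨w, hw⟩ := h
    rw [← sub_eq_zero, ← eval₂_sub, hw, eval₂_mul, eval₂_eq_eval_map]
    have := (mem_rootSet.mp ht).2
    rw [coe_aeval_eq_eval] at this
    rw [this, zero_mul]
  let e : {χ : R →+* Ω // χ.comp (algebraMap A R) = ψ} ≃ P.rootSet Ω :=
    { toFun := fun χ => ⟨χ.1 θ, by
        rw [mem_rootSet, coe_aeval_eq_eval]
        refine ⟨hPmonic.ne_zero, ?_⟩
        rw [hP, ← eval₂_eq_eval_map, ← hχ χ.1 χ.2, minpoly.aeval, map_zero]⟩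
      invFun := fun t => ⟨
        { toFun := fun r => (ψ a)⁻¹ * eval₂ ψ t.1 (Q r)
          map_one' := by
            rw [hwd t.1 t.2 (Q 1) (C a) (by rw [hQ, aeval_C, Algebra.smul_def, mul_one]),
              eval₂_C, inv_mul_cancel₀ hψa]
          map_zero' := by
            rw [hwd t.1 t.2 (Q 0) 0 (by rw [hQ, map_zero, smul_zero]), eval₂_zero, mul_zero]
          map_mul' := fun r s => by
            have := hwd t.1 t.2 (C a * Q (r * s)) (Q r * Q s) (by
              simp only [map_mul, hQ, aeval_C, Algebra.smul_def]; ring)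
            rw [eval₂_mul, eval₂_mul, eval₂_C] at this
            field_simp
            linear_combination this
          map_add' := fun r s => by
            rw [hwd t.1 t.2 (Q (r + s)) (Q r + Q s) (by simp [hQ]), eval₂_add, mul_add] }, by
        ext x
        change (ψ a)⁻¹ * eval₂ ψ t.1 (Q (algebraMap A R x)) = ψ x
        rw [hwd t.1 t.2 _ (C (a * x)) (by rw [hQ, aeval_C, map_mul, Algebra.smul_def]), eval₂_C,
          map_mul, inv_mul_cancel_left₀ hψa]⟩
      left_inv := fun χ => by
        ext r
        change (ψ a)⁻¹ * eval₂ ψ (χ.1 θ) (Q r) = χ.1 r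
        rw [← hχ χ.1 χ.2, hQ, Algebra.smul_def, map_mul]
        rw [show χ.1 (algebraMap A R a) = ψ a from RingHom.congr_fun χ.2 a,
          inv_mul_cancel_left₀ hψa]
      right_inv := fun t => by
        ext
        change (ψ a)⁻¹ * eval₂ ψ t.1 (Q θ) = t.1
        rw [hwd t.1 t.2 _ (C a * X) (by simp [hQ, Algebra.smul_def]), eval₂_mul, eval₂_C, eval₂_X,
          inv_mul_cancel_left₀ hψa] }
  exact ⟨Finite.of_equiv _ e.symm, (Nat.card_congr e).trans hcard⟩

section PolynomialSystem

open MvPolynomial Filter Topology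

theorem MvPolynomial.finrank_restrictTotalDegree (σ F : Type*) [Fintype σ] [Field F] (D : ℕ) :
    Module.finrank F (restrictTotalDegree σ F D) = (D + Fintype.card σ).choose (Fintype.card σ) := by
  classical
  have hdisj : (Finset.range (D + 1) : Set ℕ).PairwiseDisjoint
      fun n => Finset.finsuppAntidiag (Finset.univ : Finset σ) n := by
    intro a _ b _ hab
    rw [Function.onFun, Finset.disjoint_left]
    intro x hx hx'
    rw [Finset.mem_finsuppAntidiag] at hx hx'
    exact hab (hx.1.symm.trans hx'.1)
  have hS : { n : σ →₀ ℕ | (n.sum fun _ e => e) ≤ D } =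
      ((Finset.range (D + 1)).disjiUnion _ hdisj : Finset (σ →₀ ℕ)) := by
    ext n
    rw [SetLike.mem_coe, Finset.mem_disjiUnion]
    simp [Finset.mem_finsuppAntidiag, Finsupp.sum_fintype]
  rw [restrictTotalDegree, hS, Module.finrank_eq_nat_card_basis (basisRestrictSupport F _)]
  simp only [SetLike.coe_sort_coe, Nat.card_eq_fintype_card, Fintype.card_coe]
  rw [Finset.card_disjiUnion]
  simp only [Finset.card_finsuppAntidiag_nat_eq_multichoose, Finset.card_univ]
  exact Nat.sum_range_multichoose _ _

theorem Nat.cast_choose_add_eq_prod_div (n M : ℕ) :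
    ((n + M).choose M : ℝ) = (∏ i ∈ Finset.range M, ((n : ℝ) + 1 + i)) / (M.factorial : ℝ) := by
  rw [eq_div_iff (by positivity), mul_comm]
  have := Nat.ascFactorial_eq_factorial_mul_choose n M
  rw [Nat.ascFactorial_eq_prod_range] at this
  exact_mod_cast this.symm

theorem tendsto_choose_mul_add_div_choose (k M e c : ℕ) :
    Tendsto (fun n : ℕ => ((k * n + e + M).choose M : ℝ) / ((n + c + M).choose M : ℝ)) atTop
      (𝓝 ((k : ℝ) ^ M)) := by
  have h (i : ℕ) :
      Tendsto (fun n : ℕ => (((k * n + e : ℕ) : ℝ) + 1 + i) / (((n + c : ℕ) : ℝ) + 1 + i))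
      atTop (𝓝 (k : ℝ)) := by
    have h1 : Tendsto (fun n : ℕ => ((n : ℝ))⁻¹) atTop (𝓝 0) := tendsto_inv_atTop_nhds_zero_nat
    have h2 : Tendsto
        (fun n : ℕ => ((k : ℝ) + (e + 1 + i) * (n : ℝ)⁻¹) / (1 + (c + 1 + i) * (n : ℝ)⁻¹))
        atTop (𝓝 (((k : ℝ) + (e + 1 + i) * 0) / (1 + (c + 1 + i) * 0))) :=
      ((h1.const_mul _).const_add _).div ((h1.const_mul _).const_add _) (by simp)
    simp only [mul_zero, add_zero, div_one] at h2
    refine h2.congr' ?_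
    filter_upwards [eventually_gt_atTop 0] with n hn
    have : (n : ℝ) ≠ 0 := by positivity
    push_cast
    field_simp
    ring
  have h3 := tendsto_finsetProd (Finset.range M) fun i _ => h i
  simp only [Finset.prod_const, Finset.card_range] at h3
  refine h3.congr fun n => ?_
  rw [Nat.cast_choose_add_eq_prod_div, Nat.cast_choose_add_eq_prod_div,
    div_div_div_cancel_right₀ (by positivity), Finset.prod_div_distrib]

theorem eq_pow_of_choose_bounds {ρ k M e c : ℕ}
    (hl : ∀ n : ℕ, ρ * (n + M).choose M ≤ (k * n + e + M).choose M)
    (hu : ∀ n : ℕ, (k * n + M).choose M ≤ ρ * (n + c + M).choose M) : ρ = k ^ M := by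
  have hpos (n : ℕ) : (0 : ℝ) < ((n + M).choose M : ℝ) := by
    exact_mod_cast Nat.choose_pos (Nat.le_add_left _ _)
  have h1 : (ρ : ℝ) ≤ (k : ℝ) ^ M := by
    refine ge_of_tendsto' (tendsto_choose_mul_add_div_choose k M e 0) fun n => ?_
    rw [le_div_iff₀ (hpos _)]
    exact_mod_cast hl n
  have h2 : (k : ℝ) ^ M ≤ ρ := by
    refine le_of_tendsto' (tendsto_choose_mul_add_div_choose k M 0 c) fun n => ?_
    rw [div_le_iff₀ (hpos _)]
    exact_mod_cast hu n
  exact_mod_cast le_antisymm h1 h2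

theorem MvPolynomial.totalDegree_aeval_le_of_isHomogeneous {σ τ F : Type*} [CommSemiring F]
    {φ : τ → MvPolynomial σ F} {d : ℕ} (hφ : ∀ j, (φ j).IsHomogeneous d) (a : MvPolynomial τ F) :
    (aeval φ a).totalDegree ≤ d * a.totalDegree := by
  conv_lhs => rw [← sum_homogeneousComponent a, map_sum]
  refine totalDegree_finsetSum_le fun i hi => ?_
  refine (((homogeneousComponent_isHomogeneous i a).aeval φ hφ).totalDegree_le).trans ?_
  exact Nat.mul_le_mul_left _ (Nat.lt_succ_iff.mp (Finset.mem_range.mp hi))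

theorem MvPolynomial.IsHomogeneous.homogeneousComponent_mul_add {σ F : Type*} [CommSemiring F]
    {φ : MvPolynomial σ F} {d : ℕ} (hφ : φ.IsHomogeneous d) (n : ℕ) (c : MvPolynomial σ F) :
    homogeneousComponent (n + d) (c * φ) = homogeneousComponent n c * φ := by
  conv_lhs => rw [← sum_homogeneousComponent c, Finset.sum_mul, map_sum]
  have h (i : ℕ) : homogeneousComponent (n + d) (homogeneousComponent i c * φ) =
      if n = i then homogeneousComponent n c * φ else 0 := by
    rw [homogeneousComponent_of_mem ((homogeneousComponent_isHomogeneous i c).mul hφ)]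
    simp only [Nat.add_right_cancel_iff]
    split_ifs with h
    · rw [h]
    · rfl
  rw [Finset.sum_congr rfl fun i _ => h i, Finset.sum_ite_eq]
  split_ifs with hn
  · rfl
  · rw [homogeneousComponent_eq_zero _ _ (by simpa using hn), zero_mul]

section HomogeneousSystem

variable {σ τ F : Type*} [Fintype σ] [Fintype τ] [Field F]
  {φ : τ → MvPolynomial σ F} {d : ℕ}

theorem exists_X_pow_eq_sum_mul [IsAlgClosed F] (hφ : ∀ j, (φ j).IsHomogeneous d)
    (hz : ∀ x : σ → F, (∀ j, eval x (φ j) = 0) → x = 0) :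
    ∃ N, ∀ i, ∃ g : τ → MvPolynomial σ F, (∀ j, (g j).totalDegree ≤ N) ∧
      X i ^ (N + d) = ∑ j, g j * φ j := by
  have hrad (i : σ) : X i ∈ (Ideal.span (Set.range φ)).radical := by
    rw [← vanishingIdeal_zeroLocus_eq_radical (K := F), mem_vanishingIdeal_iff]
    intro x hx
    have : x = 0 := hz x fun j => by
      simpa using hx (φ j) (Ideal.subset_span (Set.mem_range_self j))
    simp [this]
  choose n hn using hrad
  refine ⟨∑ i, n i, fun i => ?_⟩
  have hi : X i ^ (∑ i, n i + d) ∈ Ideal.span (Set.range φ) :=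
    Ideal.pow_mem_of_pow_mem _ (hn i)
      ((Finset.single_le_sum (fun _ _ => Nat.zero_le _) (Finset.mem_univ i)).trans
        (Nat.le_add_right _ _))
  obtain ⟨c, hc⟩ := Ideal.mem_span_range_iff_exists_fun.mp hi
  refine ⟨fun j => homogeneousComponent (∑ i, n i) (c j),
    fun j => (homogeneousComponent_isHomogeneous _ _).totalDegree_le, ?_⟩
  rw [← homogeneousComponent_eq_self (isHomogeneous_X_pow i (∑ i, n i + d)), ← hc, map_sum]
  exact Finset.sum_congr rfl fun j _ => (hφ j).homogeneousComponent_mul_add _ _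

/-- The span of finitely many polynomials over the subalgebra generated by a homogeneous system,
with an explicit degree bound. -/
theorem exists_forall_totalDegree_le_eq_sum_aeval_mul [IsAlgClosed F] (hd : 0 < d)
    (hφ : ∀ j, (φ j).IsHomogeneous d)
    (hz : ∀ x : σ → F, (∀ j, eval x (φ j) = 0) → x = 0) :
    ∃ (B : Finset (σ →₀ ℕ)), ∀ (D : ℕ) (p : MvPolynomial σ F), p.totalDegree ≤ D →
      ∃ a : B → MvPolynomial τ F, (∀ b, d * (a b).totalDegree ≤ D) ∧
        p = ∑ b, aeval φ (a b) * monomial b.1 1 := by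
  classical
  obtain ⟨N, hN⟩ := exists_X_pow_eq_sum_mul hφ hz
  choose g hgd hg using hN
  let B : Finset (σ →₀ ℕ) := Finset.Iic (Finsupp.equivFunOnFinite.symm fun _ => N + d)
  have hB (m : σ →₀ ℕ) : m ∈ B ↔ ∀ i, m i ≤ N + d := by
    simp [B, Finsupp.le_def]
  refine ⟨B, fun D => ?_⟩
  induction D using Nat.strong_induction_on with
  | _ D ih =>
  let W : Submodule F (MvPolynomial σ F) :=
    { carrier := {p | ∃ a : B → MvPolynomial τ F, (∀ b, d * (a b).totalDegree ≤ D) ∧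
        p = ∑ b, aeval φ (a b) * monomial b.1 1}
      zero_mem' := ⟨0, by simp, by simp⟩
      add_mem' := by
        rintro _ _ ⟨a, ha, rfl⟩ ⟨a', ha', rfl⟩
        refine ⟨a + a', fun b => ?_, by simp [add_mul, Finset.sum_add_distrib]⟩
        refine (Nat.mul_le_mul_left d (totalDegree_add _ _)).trans ?_
        rcases max_cases (a b).totalDegree (a' b).totalDegree with h | h <;> rw [h.1]
        exacts [ha b, ha' b]
      smul_mem' := by
        rintro c _ ⟨a, ha, rfl⟩
        refine ⟨c • a, fun b => ?_, by simp [Finset.smul_sum]⟩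
        exact (Nat.mul_le_mul_left d (totalDegree_smul_le _ _)).trans (ha b) }
  suffices h : restrictTotalDegree σ F D ≤ W from
    fun p hp => h ((mem_restrictTotalDegree _ _ _).mpr hp)
  rw [restrictTotalDegree, restrictSupport_eq_span, Submodule.span_le]
  rintro _ ⟨m, hm, rfl⟩
  change (m.sum fun _ e => e) ≤ D at hm
  by_cases hmB : m ∈ B
  · refine ⟨Pi.single ⟨m, hmB⟩ 1, fun b => ?_, ?_⟩
    · rcases eq_or_ne b ⟨m, hmB⟩ with rfl | h
      · simp
      · simp [Pi.single_eq_of_ne h]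
    · rw [Finset.sum_eq_single ⟨m, hmB⟩]
      · simp
      · intro b _ hb
        simp [Pi.single_eq_of_ne hb]
      · simp
  · rw [hB] at hmB
    push Not at hmB
    obtain ⟨i, hi⟩ := hmB
    obtain ⟨m', rfl⟩ : ∃ m', m = Finsupp.single i (N + d) + m' :=
      ⟨m - Finsupp.single i (N + d), by
        rw [add_tsub_cancel_of_le]
        rw [Finsupp.single_le_iff]
        exact hi.le⟩
    have hdeg : N + d + (m'.sum fun _ e => e) ≤ D := by
      rwa [Finsupp.sum_add_index' (by simp) (by simp), Finsupp.sum_single_index rfl] at hm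
    have hmon : (monomial (Finsupp.single i (N + d) + m') 1 : MvPolynomial σ F) =
        ∑ j, φ j * (g i j * monomial m' 1) := by
      rw [← one_mul (1 : F), ← monomial_mul, ← X_pow_eq_monomial, hg, Finset.sum_mul]
      refine Finset.sum_congr rfl fun j _ => by simp; ring
    change monomial _ 1 ∈ W
    rw [hmon]
    refine Submodule.sum_mem _ fun j _ => ?_
    obtain ⟨a, ha, hp⟩ := ih (D - d) (by omega) (g i j * monomial m' 1) (by
      refine (totalDegree_mul _ _).trans ?_
      rw [totalDegree_monomial _ one_ne_zero]
      have := hgd i j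
      omega)
    refine ⟨fun b => X j * a b, fun b => ?_, ?_⟩
    · change d * (X j * a b).totalDegree ≤ D
      have h1 := totalDegree_mul (X j) (a b)
      rw [totalDegree_X] at h1
      have h2 := Nat.mul_le_mul_left d h1
      have h3 := ha b
      rw [mul_add] at h2
      omega
    · rw [hp, Finset.mul_sum]
      simp [mul_assoc]

end HomogeneousSystem

/-- If the linearly independent family `f` has maximal size then the quotient by its span is
torsion. -/
theorem exists_smul_mem_span_range {A R : Type*} [CommRing A] [IsDomain A] [AddCommGroup R]
    [Module A R] [Module.Finite A R] {f : Fin (Module.finrank A R) → R}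
    (hf : LinearIndependent A f) (r : R) :
    ∃ a : A, a ≠ 0 ∧ a • r ∈ Submodule.span A (Set.range f) := by
  by_contra! h
  have hli : LinearIndependent A (Fin.cons r f : Fin (Module.finrank A R + 1) → R) := by
    refine hf.finCons' r f fun c y hy hcy => ?_
    by_contra hc
    refine h c hc ?_
    rw [eq_neg_of_add_eq_zero_left hcy]
    exact Submodule.neg_mem _ hy
  have := hli.fintype_card_le_finrank
  simp at this

section GenericFiber

variable {σ τ F : Type*} [Fintype σ] [Fintype τ] [Field F]
  {φ : τ → MvPolynomial σ F} {d : ℕ}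

/-- The rank of a polynomial ring over the subring generated by a homogeneous system of
parameters of degree `d`. -/
theorem finrank_eq_pow_of_isHomogeneous [Algebra (MvPolynomial τ F) (MvPolynomial σ F)]
    [Module.Finite (MvPolynomial τ F) (MvPolynomial σ F)]
    [FaithfulSMul (MvPolynomial τ F) (MvPolynomial σ F)]
    (halg : ∀ a : MvPolynomial τ F, algebraMap _ (MvPolynomial σ F) a = aeval φ a)
    (hcard : Fintype.card σ = Fintype.card τ)
    (hφ : ∀ j, (φ j).IsHomogeneous d) (hd : 0 < d) (B : Finset (σ →₀ ℕ))
    (hB : ∀ (D : ℕ) (p : MvPolynomial σ F), p.totalDegree ≤ D →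
      ∃ a : B → MvPolynomial τ F, (∀ b, d * (a b).totalDegree ≤ D) ∧
        p = ∑ b, aeval φ (a b) * monomial b.1 1) :
    Module.finrank (MvPolynomial τ F) (MvPolynomial σ F) = d ^ Fintype.card σ := by
  have hsmul (a : MvPolynomial τ F) (r : MvPolynomial σ F) : a • r = aeval φ a * r := by
    rw [Algebra.smul_def, halg]
  obtain ⟨f, hf⟩ := exists_linearIndependent_of_le_finrank
    (le_refl (Module.finrank (MvPolynomial τ F) (MvPolynomial σ F)))
  let Θ : (Fin (Module.finrank (MvPolynomial τ F) (MvPolynomial σ F)) → MvPolynomial τ F) →ₗ[F]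
      MvPolynomial σ F :=
    { toFun := fun a => ∑ i, aeval φ (a i) * f i
      map_add' := fun a b => by simp [add_mul, Finset.sum_add_distrib]
      map_smul' := fun c a => by simp [Finset.smul_sum] }
  have hΘ : Function.Injective Θ := by
    rw [← LinearMap.ker_eq_bot, LinearMap.ker_eq_bot']
    intro a ha
    rw [Fintype.linearIndependent_iff] at hf
    funext i
    refine hf a ?_ i
    simp only [hsmul]
    exact ha
  let ι (n : ℕ) : (Fin (Module.finrank (MvPolynomial τ F) (MvPolynomial σ F)) →
      restrictTotalDegree τ F n) →ₗ[F]
      (Fin (Module.finrank (MvPolynomial τ F) (MvPolynomial σ F)) → MvPolynomial τ F) :=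
    LinearMap.pi fun i => (restrictTotalDegree τ F n).subtype ∘ₗ LinearMap.proj i
  have hι (n : ℕ) : Function.Injective (ι n) := fun a b hab => by
    funext i
    exact Subtype.ext (congrFun hab i)
  have hrank (n : ℕ) : Module.finrank F (Fin (Module.finrank (MvPolynomial τ F) (MvPolynomial σ F)) →
      restrictTotalDegree τ F n) = Module.finrank (MvPolynomial τ F) (MvPolynomial σ F) *
        (n + Fintype.card σ).choose (Fintype.card σ) := by
    rw [Module.finrank_pi_fintype]
    simp [finrank_restrictTotalDegree, hcard]
  have hdom : IsDomain (MvPolynomial τ F) := inferInstance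
  have htors (b : B) := exists_smul_mem_span_range hf (monomial b.1 1)
  choose s hs0 hs using htors
  have hsB (b : B) : ∃ β, (∏ b, s b) • monomial b.1 1 = Θ β := by
    classical
    obtain ⟨β, hβ⟩ := (Submodule.mem_span_range_iff_exists_fun _).mp (hs b)
    refine ⟨fun i => (∏ b' ∈ Finset.univ.erase b, s b') * β i, ?_⟩
    rw [← Finset.prod_erase_mul _ _ (Finset.mem_univ b), mul_smul, ← hβ, Finset.smul_sum]
    exact Finset.sum_congr rfl fun i _ => by rw [smul_smul, hsmul]
  choose β hβ using hsB
  have hs' : ∏ b, s b ≠ 0 := Finset.prod_ne_zero_iff.mpr fun b _ => hs0 b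
  refine eq_pow_of_choose_bounds (e := Finset.univ.sup fun i => (f i).totalDegree)
    (c := Finset.univ.sup fun b => Finset.univ.sup fun i => (β b i).totalDegree)
    (fun n => ?_) (fun n => ?_)
  · rw [← hrank, ← finrank_restrictTotalDegree σ F]
    refine LinearMap.finrank_le_finrank_of_injective
      (f := (Θ ∘ₗ ι n).codRestrict (restrictTotalDegree σ F _) fun a => ?_) ?_
    · rw [mem_restrictTotalDegree]
      refine totalDegree_finsetSum_le fun i _ => (totalDegree_mul _ _).trans ?_
      refine add_le_add ?_ (Finset.le_sup (f := fun i => (f i).totalDegree) (Finset.mem_univ i))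
      refine (totalDegree_aeval_le_of_isHomogeneous hφ _).trans (Nat.mul_le_mul_left _ ?_)
      exact (mem_restrictTotalDegree _ _ _).mp (a i).2
    · intro a b hab
      exact hι n (hΘ (congrArg Subtype.val hab))
  · rw [← hrank, ← finrank_restrictTotalDegree σ F]
    have hsub : (restrictTotalDegree σ F (d * n)).map
        (LinearMap.mulLeft F (algebraMap _ (MvPolynomial σ F) (∏ b, s b))) ≤
        LinearMap.range (Θ ∘ₗ ι (n + Finset.univ.sup fun b =>
          Finset.univ.sup fun i => (β b i).totalDegree)) := by
      rintro _ ⟨p, hp, rfl⟩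
      obtain ⟨a, ha, rfl⟩ := hB (d * n) p ((mem_restrictTotalDegree _ _ _).mp hp)
      refine ⟨fun i => ⟨∑ b, a b * β b i, ?_⟩, ?_⟩
      · rw [mem_restrictTotalDegree]
        refine totalDegree_finsetSum_le fun b _ => (totalDegree_mul _ _).trans (add_le_add ?_ ?_)
        · exact Nat.le_of_mul_le_mul_left (ha b) hd
        · exact (Finset.le_sup (f := fun i => (β b i).totalDegree) (Finset.mem_univ i)).trans
            (Finset.le_sup (f := fun b => Finset.univ.sup fun i => (β b i).totalDegree)
              (Finset.mem_univ b))
      · change ∑ i, aeval φ (∑ b, a b * β b i) * f i =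
          algebraMap _ (MvPolynomial σ F) (∏ b, s b) * ∑ b, aeval φ (a b) * monomial b.1 1
        simp only [map_sum, map_mul (aeval φ), Finset.sum_mul]
        rw [Finset.sum_comm, Finset.mul_sum]
        refine Finset.sum_congr rfl fun b _ => ?_
        have h1 : (algebraMap (MvPolynomial τ F) (MvPolynomial σ F)) (∏ b, s b) * monomial b.1 1 =
            ∑ i, aeval φ (β b i) * f i := by
          rw [← Algebra.smul_def]; exact hβ b
        rw [mul_left_comm, h1, Finset.mul_sum]
        exact Finset.sum_congr rfl fun i _ => mul_assoc _ _ _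
    have hinj : Function.Injective
        (LinearMap.mulLeft F (algebraMap _ (MvPolynomial σ F) (∏ b, s b))) := by
      intro p q hpq
      refine mul_left_cancel₀ ?_ hpq
      rwa [Ne, FaithfulSMul.algebraMap_eq_zero_iff]
    rw [(Submodule.equivMapOfInjective _ hinj _).finrank_eq]
    exact (Submodule.finrank_mono hsub).trans (LinearMap.finrank_range_le _)

theorem exists_generic_ncard_fiber_eq_pow [IsAlgClosed F] [CharZero F]
    (hcard : Fintype.card σ = Fintype.card τ) (hφ : ∀ j, (φ j).IsHomogeneous d) (hd : 0 < d)
    (hz : ∀ x : σ → F, (∀ j, eval x (φ j) = 0) → x = 0) :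
    ∃ G : MvPolynomial τ F, G ≠ 0 ∧ ∀ y : τ → F, eval y G ≠ 0 →
      {x : σ → F | ∀ j, eval x (φ j) = y j}.Finite ∧
      {x : σ → F | ∀ j, eval x (φ j) = y j}.ncard = d ^ Fintype.card σ := by
  classical
  obtain ⟨B, hB⟩ := exists_forall_totalDegree_le_eq_sum_aeval_mul hd hφ hz
  algebraize_only [(aeval φ : MvPolynomial τ F →ₐ[F] MvPolynomial σ F).toRingHom]
  have halg : ∀ a : MvPolynomial τ F, algebraMap _ (MvPolynomial σ F) a = aeval φ a := fun _ => rfl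
  have : IsScalarTower F (MvPolynomial τ F) (MvPolynomial σ F) := .of_algebraMap_eq fun c => by
    rw [halg, AlgHom.commutes]
  have hfin : Module.Finite (MvPolynomial τ F) (MvPolynomial σ F) := by
    refine ⟨⟨Finset.univ.image fun b : B => monomial b.1 1, ?_⟩⟩
    rw [eq_top_iff]
    intro p _
    obtain ⟨a, -, rfl⟩ := hB _ p le_rfl
    refine Submodule.sum_mem _ fun b _ => ?_
    rw [← halg, ← Algebra.smul_def]
    exact Submodule.smul_mem _ _ (Submodule.subset_span (by simp))
  have hinj : Function.Injective (aeval φ : MvPolynomial τ F →ₐ[F] MvPolynomial σ F) := by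
    have : Algebra.IsAlgebraic (Algebra.adjoin F (Set.range φ)) (MvPolynomial σ F) := by
      let g : MvPolynomial τ F →+* Algebra.adjoin F (Set.range φ) :=
        ((aeval φ).codRestrict (Algebra.adjoin F (Set.range φ)) fun p => by
          rw [Algebra.adjoin_range_eq_range_aeval]; exact ⟨p, rfl⟩).toRingHom
      have hg : (algebraMap (Algebra.adjoin F (Set.range φ)) (MvPolynomial σ F)).IsIntegral :=
        RingHom.IsIntegral.tower_top g _
          (algebraMap_isIntegral_iff.mpr
            (inferInstanceAs (Algebra.IsIntegral (MvPolynomial τ F) (MvPolynomial σ F))))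
      have := algebraMap_isIntegral_iff.mp hg
      infer_instance
    exact (Algebra.IsAlgebraic.isTranscendenceBasis_of_lift_le_trdeg_of_finite F φ
      (by rw [MvPolynomial.trdeg_of_isDomain]; simp [hcard])).1
  have : FaithfulSMul (MvPolynomial τ F) (MvPolynomial σ F) :=
    (faithfulSMul_iff_algebraMap_injective _ _).mpr hinj
  obtain ⟨G, hG, h⟩ := exists_generic_card_fiber (MvPolynomial τ F) (MvPolynomial σ F) F
  refine ⟨G, hG, fun y hy => ?_⟩
  obtain ⟨h1, h2⟩ := h (eval y) hy
  rw [finrank_eq_pow_of_isHomogeneous halg hcard hφ hd B hB] at h2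
  let e : {χ : MvPolynomial σ F →+* F // χ.comp (algebraMap (MvPolynomial τ F) _) = eval y} ≃
      {x : σ → F | ∀ j, eval x (φ j) = y j} :=
    { toFun := fun χ => ⟨fun i => χ.1 (X i), fun j => by
        have hC (c : F) : χ.1 (C c) = c := by
          have := RingHom.congr_fun χ.2 (C c)
          rwa [RingHom.comp_apply, halg, aeval_C, eval_C] at this
        have hχ : eval (fun i => χ.1 (X i)) = χ.1 := by
          apply MvPolynomial.ringHom_ext <;> simp [hC]
        rw [hχ]
        have := RingHom.congr_fun χ.2 (X j)
        rwa [RingHom.comp_apply, halg, aeval_X, eval_X] at this⟩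
      invFun := fun x => ⟨eval x.1, by
        apply MvPolynomial.ringHom_ext
        · intro c
          rw [RingHom.comp_apply, halg, aeval_C]
          simp
        · intro j
          rw [RingHom.comp_apply, halg, aeval_X, eval_X]
          exact x.2 j⟩
      left_inv := fun χ => by
        have hC (c : F) : χ.1 (C c) = c := by
          have := RingHom.congr_fun χ.2 (C c)
          rwa [RingHom.comp_apply, halg, aeval_C, eval_C] at this
        ext : 1
        apply MvPolynomial.ringHom_ext <;> simp [hC]
      right_inv := fun x => by
        ext i
        simp }
  refine ⟨Finite.of_equiv _ e, ?_⟩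
  rw [← Nat.card_coe_set_eq, ← Nat.card_congr e, h2]

end GenericFiber

end PolynomialSystem

section CompleteHomogeneous

variable {F : Type*} [Field F]

namespace Polynomial

/-- Polynomials of degree less than `#Y` are spanned by the products of all but one of the
factors `1 - y X`, `y ∈ Y`. -/
theorem exists_eq_sum_C_mul_prod_erase [DecidableEq F] {Y : Finset F} (hY : ∀ y ∈ Y, y ≠ 0)
    {p : F[X]} (hp : p.degree < Y.card) :
    ∃ c : F → F, p = ∑ y ∈ Y, C (c y) * ∏ z ∈ Y.erase y, (1 - C z * X) := by
  have h := Lagrange.eq_interpolate (v := fun y : F => y⁻¹) (s := Y)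
    (fun _ _ _ _ hab => inv_injective hab) hp
  refine ⟨fun y => eval y⁻¹ p * ∏ z ∈ Y.erase y, ((y⁻¹ - z⁻¹)⁻¹ * -z⁻¹), ?_⟩
  conv_lhs => rw [h, Lagrange.interpolate_apply]
  refine Finset.sum_congr rfl fun y _ => ?_
  rw [Lagrange.basis, C_mul, mul_assoc, map_prod, ← Finset.prod_mul_distrib]
  congr 1
  refine Finset.prod_congr rfl fun z hz => ?_
  have hz0 : z ≠ 0 := hY z (Finset.mem_of_mem_erase hz)
  have h1 : C z⁻¹ * C z = (1 : F[X]) := by rw [← C_mul, inv_mul_cancel₀ hz0, C_1]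
  rw [Lagrange.basisDivisor, C_mul, C_neg]
  linear_combination (-(C (y⁻¹ - z⁻¹)⁻¹ * X)) * h1

/-- The logarithmic derivative of `∏ (1 - x i X)` has denominator `∏ (1 - y X)`, with `y` running
over the nonzero values of `x`. -/
theorem exists_prod_mul_derivative_eq [DecidableEq F] {Y : Finset F}
    {ι : Type*} (s : Finset ι) (x : ι → F) (hx : ∀ i ∈ s, x i ≠ 0 → x i ∈ Y) :
    ∃ R : F[X], R.degree < Y.card ∧ (∏ y ∈ Y, (1 - C y * X)) *
      derivative (∏ i ∈ s, (1 - C (x i) * X)) = R * ∏ i ∈ s, (1 - C (x i) * X) := by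
  classical
  induction s using Finset.induction_on with
  | empty => exact ⟨0, by simp, by simp⟩
  | insert i s his ih =>
    obtain ⟨R, hR, h⟩ := ih fun j hj => hx j (Finset.mem_insert_of_mem hj)
    simp only [Finset.prod_insert his, derivative_mul]
    rcases eq_or_ne (x i) 0 with h0 | h0
    · exact ⟨R, hR, by simpa [h0] using h⟩
    · have hi : x i ∈ Y := hx i (Finset.mem_insert_self _ _) h0
      refine ⟨R - C (x i) * ∏ y ∈ Y.erase (x i), (1 - C y * X), ?_, ?_⟩
      · refine (degree_sub_le _ _).trans_lt (max_lt hR ?_)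
        refine (degree_mul_le _ _).trans_lt ?_
        have h1 : (∏ y ∈ Y.erase (x i), (1 - C y * X)).degree ≤ ((Y.card - 1 : ℕ) : WithBot ℕ) := by
          rw [← Finset.card_erase_of_mem hi]
          refine (degree_prod_le _ _).trans ?_
          have : ∑ y ∈ Y.erase (x i), (1 - C y * X).degree ≤ ∑ _y ∈ Y.erase (x i), (1 : WithBot ℕ) :=
            Finset.sum_le_sum fun y _ => by compute_degree
          simpa using this
        have h2 : (C (x i)).degree ≤ 0 := degree_C_le
        have h3 := Finset.card_pos.mpr ⟨_, hi⟩
        refine (add_le_add h2 h1).trans_lt ?_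
        rw [zero_add]
        exact_mod_cast Nat.sub_lt h3 one_pos
      · rw [← Finset.mul_prod_erase Y _ hi] at h ⊢
        simp only [derivative_sub, derivative_one, derivative_C_mul, derivative_X]
        linear_combination (1 - C (x i) * X) * h

end Polynomial

namespace PowerSeries

theorem mk_pow_mul_one_sub (y : F) : mk (fun n => y ^ n) * (1 - C y * X) = 1 := by
  ext n
  rw [mul_sub, mul_one, ← mul_assoc, map_sub]
  cases n with
  | zero => simp
  | succ n =>
    rw [coeff_succ_mul_X, mul_comm, coeff_C_mul]
    simp [pow_succ']

/-- The partial derivatives of the complete homogeneous polynomial, via generating functions. -/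
theorem sum_finsuppAntidiag_mul_prod_pow {σ : Type*} [Fintype σ] [DecidableEq σ] (x : σ → F)
    (k : ℕ) (i : σ) :
    ∑ β ∈ Finset.finsuppAntidiag Finset.univ (k + 1), (β i : F) * ∏ j, x j ^ β j =
      x i * coeff k (mk (fun n => x i ^ n) * ∏ j, mk fun n => x j ^ n) := by
  have h1 : mk (fun n => (n : F) * x i ^ n) =
      X * (C (x i) * mk (fun n => x i ^ n) * mk fun n => x i ^ n) := by
    have h := mk_pow_mul_one_sub (x i)
    have hd := congrArg (derivative F) h
    have hC : derivative F (C (x i)) = 0 := by ext n; simp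
    have hX : derivative F X = 1 := by
      ext n; simp
    simp only [Derivation.leibniz, smul_eq_mul, map_sub, Derivation.map_one_eq_zero, hC, hX] at hd
    have hm : mk (fun n => (n : F) * x i ^ n) = X * derivative F (mk fun n => x i ^ n) := by
      ext n
      cases n with
      | zero => simp
      | succ n => simp [coeff_succ_X_mul, coeff_derivative, mul_comm]
    rw [hm]
    congr 1
    linear_combination (mk fun n => x i ^ n) * hd - derivative F (mk fun n => x i ^ n) * h
  have h2 : coeff (k + 1) (∏ j, mk fun n => (if j = i then (n : F) else 1) * x j ^ n) =
      ∑ β ∈ Finset.finsuppAntidiag Finset.univ (k + 1), (β i : F) * ∏ j, x j ^ β j := by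
    rw [coeff_prod]
    refine Finset.sum_congr rfl fun β _ => ?_
    simp only [coeff_mk, Finset.prod_mul_distrib, Finset.prod_ite_eq', Finset.mem_univ, if_true]
  rw [← h2, ← Finset.mul_prod_erase _ _ (Finset.mem_univ i),
    ← Finset.mul_prod_erase Finset.univ (fun j => mk fun n => x j ^ n) (Finset.mem_univ i)]
  simp only [if_true]
  rw [h1, mul_assoc X, coeff_succ_X_mul, ← coeff_C_mul]
  congr 1
  have h3 : ∏ j ∈ Finset.univ.erase i, (mk fun n => (if j = i then (n : F) else 1) * x j ^ n) =
      ∏ j ∈ Finset.univ.erase i, mk fun n => x j ^ n :=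
    Finset.prod_congr rfl fun j hj => by simp only [if_neg (Finset.ne_of_mem_erase hj), one_mul]
  rw [h3]
  ring

theorem prod_mk_pow_mul_prod_one_sub {ι : Type*} (s : Finset ι) (x : ι → F) :
    (∏ i ∈ s, mk fun n => x i ^ n) *
      ((∏ i ∈ s, (1 - Polynomial.C (x i) * Polynomial.X) : Polynomial F) : F⟦X⟧) = 1 := by
  rw [← Polynomial.coeToPowerSeries.ringHom_apply, map_prod, ← Finset.prod_mul_distrib]
  refine Finset.prod_eq_one fun i _ => ?_
  simpa using mk_pow_mul_one_sub (x i)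

/-- A power series solution of a first-order linear differential equation with polynomial
coefficients vanishes from the first long enough run of zero coefficients on. -/
theorem coeff_eq_zero_of_mul_derivative_eq [CharZero F] {Q R : Polynomial F} {G : F⟦X⟧} {r m : ℕ}
    (hQ0 : Q.coeff 0 = 1) (hQ : Q.natDegree ≤ r) (hR : R.degree < r) (hr : 0 < r)
    (h : (Q : F⟦X⟧) * derivative F G = R * G)
    (hm : ∀ n, m ≤ n → n < m + r → coeff n G = 0) (n : ℕ) (hn : m ≤ n) : coeff n G = 0 := by
  induction n using Nat.strong_induction_on with
  | _ n ih =>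
    rcases lt_or_ge n (m + r) with hlt | hge
    · exact hm n hn hlt
    obtain ⟨l, rfl⟩ : ∃ l, n = l + 1 := ⟨n - 1, by omega⟩
    have h1 := congrArg (coeff l) h
    rw [coeff_mul, coeff_mul, Finset.sum_eq_single (0, l), Finset.sum_eq_zero] at h1
    · have h2 : (l + 1 : F) ≠ 0 := by exact_mod_cast Nat.succ_ne_zero l
      simpa [coeff_derivative, hQ0, h2] using h1
    · rintro ⟨a, b⟩ hab
      rw [Finset.HasAntidiagonal.mem_antidiagonal] at hab
      dsimp only at hab ⊢
      rcases lt_or_ge a r with ha | ha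
      · rw [ih b (by omega) (by omega), mul_zero]
      · rw [Polynomial.coeff_coe, Polynomial.coeff_eq_zero_of_degree_lt, zero_mul]
        exact hR.trans_le (by exact_mod_cast ha)
    · rintro ⟨a, b⟩ hab hne
      rw [Finset.HasAntidiagonal.mem_antidiagonal] at hab
      dsimp only at hab ⊢
      have ha0 : a ≠ 0 := by rintro rfl; exact hne (by simp_all)
      rcases le_or_gt a r with ha | ha
      · rw [coeff_derivative, ih (b + 1) (by omega) (by omega), zero_mul, mul_zero]
      · rw [Polynomial.coeff_coe, Polynomial.coeff_eq_zero_of_natDegree_lt (hQ.trans_lt ha),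
          zero_mul]
    · simp

/-- In characteristic zero, the partial derivatives of a complete homogeneous polynomial have no
common zero besides the origin. -/
theorem eq_zero_of_sum_finsuppAntidiag_eq_zero [CharZero F] {σ : Type*} [Fintype σ]
    [DecidableEq σ] {x : σ → F} {k : ℕ}
    (h : ∀ i, ∑ β ∈ Finset.finsuppAntidiag Finset.univ (k + 1),
      (β i : F) * ∏ j, x j ^ β j = 0) : x = 0 := by
  classical
  by_contra hx
  obtain ⟨i₀, hi₀⟩ := Function.ne_iff.mp hx
  set Y : Finset F := (Finset.univ.image x).erase 0 with hY
  have hmem : ∀ i, x i ≠ 0 → x i ∈ Y := fun i hi => by simp [hY, hi]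
  have hY0 : ∀ y ∈ Y, y ≠ 0 := fun y hy => Finset.ne_of_mem_erase hy
  have hYne : Y.Nonempty := ⟨x i₀, hmem i₀ hi₀⟩
  have hr := Finset.card_pos.mpr hYne
  obtain ⟨R₁, hR₁, hW₁⟩ := Polynomial.exists_prod_mul_derivative_eq Finset.univ x
    fun i _ => hmem i
  obtain ⟨R₂, hR₂, hW₂⟩ := Polynomial.exists_prod_mul_derivative_eq Y id fun i hi _ => hi
  have hHW := prod_mk_pow_mul_prod_one_sub Finset.univ x
  have hPQ := prod_mk_pow_mul_prod_one_sub Y id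
  simp only [id_eq] at hW₂ hPQ
  have hE : ∀ y ∈ Y, (mk fun n => y ^ n) *
      ((∏ z ∈ Y, (1 - Polynomial.C z * Polynomial.X) : Polynomial F) : F⟦X⟧) =
      ((∏ z ∈ Y.erase y, (1 - Polynomial.C z * Polynomial.X) : Polynomial F) : F⟦X⟧) := by
    intro y hy
    rw [← Finset.mul_prod_erase Y _ hy, Polynomial.coe_mul, ← mul_assoc]
    have := mk_pow_mul_one_sub y
    simp [this]
  have hQ0 : (∏ z ∈ Y, (1 - Polynomial.C z * Polynomial.X)).coeff 0 = 1 := by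
    simp [Polynomial.coeff_zero_eq_eval_zero, Polynomial.eval_prod]
  have hQr : (∏ z ∈ Y, (1 - Polynomial.C z * Polynomial.X)).natDegree ≤ Y.card := by
    refine (Polynomial.natDegree_prod_le _ _).trans ?_
    refine (Finset.sum_le_card_nsmul _ _ 1 fun y _ => ?_).trans (by simp)
    compute_degree
  have hroot : ((∏ z ∈ Y, (1 - Polynomial.C z * Polynomial.X)).eval (x i₀)⁻¹) = 0 := by
    rw [Polynomial.eval_prod]
    exact Finset.prod_eq_zero (hmem i₀ hi₀) (by simp [mul_inv_cancel₀ hi₀])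
  set Q : Polynomial F := ∏ z ∈ Y, (1 - Polynomial.C z * Polynomial.X)
  set W : Polynomial F := ∏ i, (1 - Polynomial.C (x i) * Polynomial.X)
  set H : F⟦X⟧ := ∏ i, mk fun n => x i ^ n with hH
  set P : F⟦X⟧ := ∏ y ∈ Y, mk fun n => y ^ n
  have hcoeff : ∀ p : Polynomial F, p.degree < Y.card → coeff k (H * P * (p : F⟦X⟧)) = 0 := by
    intro p hp
    obtain ⟨c, rfl⟩ := Polynomial.exists_eq_sum_C_mul_prod_erase hY0 hp
    rw [← Polynomial.coeToPowerSeries.ringHom_apply, map_sum, Finset.mul_sum, map_sum]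
    refine Finset.sum_eq_zero fun y hy => ?_
    obtain ⟨hy0, i, -, rfl⟩ : y ≠ 0 ∧ ∃ i ∈ Finset.univ, x i = y := by simpa [hY] using hy
    have hi := h i
    rw [sum_finsuppAntidiag_mul_prod_pow, ← hH] at hi
    rw [Polynomial.coeToPowerSeries.ringHom_apply, Polynomial.coe_mul, ← hE _ hy, Polynomial.coe_C]
    have : H * P * (C (c (x i)) * ((mk fun n => x i ^ n) * (Q : F⟦X⟧))) =
        C (c (x i)) * ((mk fun n => x i ^ n) * H) := by
      linear_combination (C (c (x i)) * (mk fun n => x i ^ n) * H) * hPQ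
    rw [this, coeff_C_mul, (mul_eq_zero.mp hi).resolve_left hy0, mul_zero]
  have hGW : H * P * ((W * Q : Polynomial F) : F⟦X⟧) = 1 := by
    rw [Polynomial.coe_mul]
    linear_combination (P * (Q : F⟦X⟧)) * hHW + hPQ
  have hrun : ∀ a < Y.card, a ≤ k → coeff (k - a) (H * P) = 0 := by
    intro a ha hak
    have := hcoeff (Polynomial.X ^ a) (by
      rw [Polynomial.degree_X_pow]; exact_mod_cast ha)
    rw [Polynomial.coe_pow, Polynomial.coe_X, coeff_mul_X_pow', if_pos hak] at this
    exact this
  have hG0 : coeff 0 (H * P) ≠ 0 := by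
    intro h0
    have := congrArg (coeff 0) hGW
    rw [coeff_mul] at this
    simp [h0] at this
  have hkr : Y.card ≤ k := by
    by_contra! hlt
    exact hG0 (by simpa using hrun k hlt le_rfl)
  have hODE : (Q : F⟦X⟧) * derivative F (H * P) =
      ((-(R₁ + R₂) : Polynomial F) : F⟦X⟧) * (H * P) := by
    have h1 := congrArg (derivative F) hGW
    rw [Derivation.leibniz, Derivation.map_one_eq_zero, derivative_coe, smul_eq_mul,
      smul_eq_mul] at h1
    have h2 : (Q : F⟦X⟧) * (Polynomial.derivative (W * Q) : Polynomial F) =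
        ((R₁ + R₂ : Polynomial F) : F⟦X⟧) * ((W * Q : Polynomial F) : F⟦X⟧) := by
      rw [← Polynomial.coe_mul, ← Polynomial.coe_mul, Polynomial.derivative_mul]
      congr 1
      linear_combination Q * hW₁ + W * hW₂
    rw [Polynomial.coe_neg]
    linear_combination (H * P * (Q : F⟦X⟧)) * h1 - (H * P) ^ 2 * h2 -
      ((Q : F⟦X⟧) * derivative F (H * P) +
        ((R₁ + R₂ : Polynomial F) : F⟦X⟧) * (H * P)) * hGW
  have hvan := coeff_eq_zero_of_mul_derivative_eq (m := k - Y.card + 1) hQ0 hQr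
    (by rw [Polynomial.degree_neg]; exact (Polynomial.degree_add_le _ _).trans_lt (max_lt hR₁ hR₂))
    hr hODE fun n hn hn' => by
      have := hrun (k - n) (by omega) (by omega)
      rwa [Nat.sub_sub_self (by omega)] at this
  have htr : ((trunc (k - Y.card + 1) (H * P) : Polynomial F) : F⟦X⟧) = H * P := by
    ext n
    rw [Polynomial.coeff_coe, coeff_trunc]
    split_ifs with hn
    · rfl
    · exact (hvan n (by omega)).symm
  rw [← htr, ← Polynomial.coe_mul, ← Polynomial.coe_one, Polynomial.coe_inj] at hGW
  have := congrArg (Polynomial.eval (x i₀)⁻¹) hGW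
  simp [hroot] at this

end PowerSeries

end CompleteHomogeneous

section Veronese

theorem Set.Finite.ncard_eq_mul_of_ncard_fiber {α β : Type*} {s : Set α} {t : Set β} {f : α → β}
    {k : ℕ} (hs : s.Finite) (hf : f '' s = t)
    (hk : ∀ b ∈ t, {a ∈ s | f a = b}.ncard = k) : s.ncard = k * t.ncard := by
  classical
  subst hf
  lift s to Finset α using hs
  rw [← Finset.coe_image, Set.ncard_coe_finset, Set.ncard_coe_finset,
    Finset.card_eq_sum_card_image f s, Finset.sum_const_nat (m := k), mul_comm]
  intro b hb
  rw [← hk b (by simpa using hb), ← Set.ncard_coe_finset, Finset.coe_filter]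
  rfl

theorem prod_pow_toNat_eq_iff_prod_zpow_eq_one {ι F : Type*} [Fintype ι] [Field F] {p : ι → F}
    (hp : ∀ j, p j ≠ 0) (v : ι → ℤ) :
    (∏ j, p j ^ (max (v j) 0).toNat) = (∏ j, p j ^ (max (-v j) 0).toNat) ↔
      ∏ j, p j ^ v j = 1 := by
  have h : ∏ j, p j ^ v j =
      (∏ j, p j ^ (max (v j) 0).toNat) / ∏ j, p j ^ (max (-v j) 0).toNat := by
    rw [← Finset.prod_div_distrib]
    refine Finset.prod_congr rfl fun j _ => ?_
    rw [← zpow_natCast, ← zpow_natCast, ← zpow_sub₀ (hp j)]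
    congr 1
    omega
  rw [h, div_eq_one_iff_eq (Finset.prod_ne_zero_iff.mpr fun j _ => pow_ne_zero _ (hp j))]

theorem Finset.prod_zpow_eq_zpow_sum₀ {ι G : Type*} [CommGroupWithZero G] {a : G} (ha : a ≠ 0)
    (s : Finset ι) (w : ι → ℤ) : ∏ i ∈ s, a ^ w i = a ^ ∑ i ∈ s, w i := by
  classical
  induction s using Finset.induction_on with
  | empty => simp
  | insert i s hi ih => rw [prod_insert hi, sum_insert hi, zpow_add₀ ha, ih]

variable {d k : ℕ}

/-- The homogenised exponent vector of a column of the Veronese matrix. -/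
def verExp (α : VerIndex d k) (i : Option (Fin (d - 1))) : ℕ :=
  i.elim (k - ∑ j, (α.1 j : ℕ)) fun j => α.1 j

theorem sum_verExp (α : VerIndex d k) : ∑ i, verExp α i = k := by
  rw [Fintype.sum_option]
  exact Nat.sub_add_cancel α.2

theorem verExp_injective : Function.Injective (verExp (d := d) (k := k)) := by
  intro α β h
  ext i
  exact congrFun h (some i)

theorem exists_verExp_eq {β : Option (Fin (d - 1)) → ℕ} (hβ : ∑ i, β i = k) :
    ∃ α : VerIndex d k, verExp α = β := by
  rw [Fintype.sum_option] at hβ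
  have hle : ∀ i, β (some i) ≤ k := fun i =>
    (Finset.single_le_sum (f := fun i => β (some i)) (fun _ _ => Nat.zero_le _)
      (Finset.mem_univ i)).trans (by omega)
  refine ⟨⟨fun i => ⟨β (some i), Nat.lt_succ_of_le (hle i)⟩, by dsimp only; omega⟩, ?_⟩
  funext i
  cases i with
  | none => simp only [verExp, Option.elim]; omega
  | some i => rfl

theorem sum_verIndex_eq_sum_finsuppAntidiag {M : Type*} [AddCommMonoid M]
    (f : (Option (Fin (d - 1)) → ℕ) → M) :
    ∑ α : VerIndex d k, f (verExp α) =
      ∑ β ∈ Finset.finsuppAntidiag Finset.univ k, f β := by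
  refine Finset.sum_bij (fun α _ => Finsupp.equivFunOnFinite.symm (verExp α)) ?_ ?_ ?_ ?_
  · intro α _
    simpa [Finset.mem_finsuppAntidiag] using sum_verExp α
  · intro α _ β _ h
    exact verExp_injective (Finsupp.equivFunOnFinite.symm.injective h)
  · intro β hβ
    obtain ⟨α, hα⟩ := exists_verExp_eq (d := d) (k := k) (β := β)
      (by simpa [Finset.mem_finsuppAntidiag] using hβ)
    exact ⟨α, Finset.mem_univ _, by rw [hα]; ext; simp⟩
  · intro α _
    simp

/-- The `i`-th logarithmic derivative of the complete homogeneous polynomial of degree `k`. -/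
noncomputable def verForm (d k : ℕ) (i : Option (Fin (d - 1))) :
    MvPolynomial (Option (Fin (d - 1))) ℂ :=
  ∑ α : VerIndex d k, MvPolynomial.C (verExp α i : ℂ) * ∏ j, MvPolynomial.X j ^ verExp α j

theorem eval_verForm (i : Option (Fin (d - 1))) (x : Option (Fin (d - 1)) → ℂ) :
    MvPolynomial.eval x (verForm d k i) =
      ∑ α : VerIndex d k, (verExp α i : ℂ) * ∏ j, x j ^ verExp α j := by
  simp [verForm]

theorem isHomogeneous_verForm (i : Option (Fin (d - 1))) : (verForm d k i).IsHomogeneous k := by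
  refine MvPolynomial.IsHomogeneous.sum _ _ _ fun α _ => ?_
  have h := MvPolynomial.IsHomogeneous.prod Finset.univ
    (fun j => (MvPolynomial.X j : MvPolynomial (Option (Fin (d - 1))) ℂ) ^ verExp α j)
    (fun j => verExp α j) fun j _ => by
      simpa using (MvPolynomial.isHomogeneous_X ℂ j).pow (verExp α j)
  rw [sum_verExp] at h
  simpa using (MvPolynomial.isHomogeneous_C _ (verExp α i : ℂ)).mul h

theorem eq_zero_of_eval_verForm_eq_zero (hk : 1 ≤ k) {x : Option (Fin (d - 1)) → ℂ}
    (h : ∀ i, MvPolynomial.eval x (verForm d k i) = 0) : x = 0 := by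
  obtain ⟨k, rfl⟩ : ∃ l, k = l + 1 := ⟨k - 1, by omega⟩
  refine PowerSeries.eq_zero_of_sum_finsuppAntidiag_eq_zero (k := k) fun i => ?_
  rw [← h i, eval_verForm]
  exact (sum_verIndex_eq_sum_finsuppAntidiag
    fun β => (β i : ℂ) * ∏ j, x j ^ β j).symm

/-- The homogenised sufficient statistics of a data vector. -/
def verData (u : VerIndex d k → ℂ) (i : Option (Fin (d - 1))) : ℂ :=
  ∑ α, (verExp α i : ℂ) * u α

theorem sum_verData (u : VerIndex d k → ℂ) : ∑ i, verData u i = k * ∑ α, u α := by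
  simp only [verData]
  rw [Finset.sum_comm, Finset.mul_sum]
  refine Finset.sum_congr rfl fun α _ => ?_
  rw [← Finset.sum_mul, ← Nat.cast_sum, sum_verExp]

theorem verData_none (u : VerIndex d k → ℂ) :
    verData u none = k * ∑ α, u α - ∑ i, verData u (some i) := by
  rw [← sum_verData, Fintype.sum_option, add_sub_cancel_right]

theorem eval_verForm_eq_verData (i : Option (Fin (d - 1))) (x : Option (Fin (d - 1)) → ℂ) :
    MvPolynomial.eval x (verForm d k i) =
      verData (fun α : VerIndex d k => ∏ j, x j ^ verExp α j) i :=
  eval_verForm i x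

theorem prod_prod_pow_verExp_zpow {x : Option (Fin (d - 1)) → ℂ} {c : ℂ}
    (hx : ∀ i, x i ≠ 0) (hc : c ≠ 0) {v : VerIndex d k → ℤ}
    (hv : ∀ i, ∑ α, verA d k i α * v α = 0) (hv1 : ∑ α, v α = 0) :
    ∏ α, (c * ∏ j, x j ^ verExp α j) ^ v α = 1 := by
  have hz : ∀ i, ∑ α, (verExp α i : ℤ) * v α = 0 := by
    have hs : ∑ i, ∑ α, (verExp α i : ℤ) * v α = 0 := by
      rw [Finset.sum_comm]
      simp only [← Finset.sum_mul, ← Nat.cast_sum, sum_verExp]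
      rw [← Finset.mul_sum, hv1, mul_zero]
    rintro (_ | i)
    · rw [Fintype.sum_option] at hs
      rwa [show ∑ i, ∑ α, (verExp α (some i) : ℤ) * v α = 0 from
        Finset.sum_eq_zero fun i _ => hv i, add_zero] at hs
    · exact hv i
  simp only [mul_zpow, ← Finset.prod_zpow, ← zpow_natCast, ← zpow_mul, Finset.prod_mul_distrib]
  rw [Finset.prod_zpow_eq_zpow_sum₀ hc, hv1, zpow_zero, one_mul, Finset.prod_comm]
  refine Finset.prod_eq_one fun j _ => ?_
  rw [Finset.prod_zpow_eq_zpow_sum₀ (hx j), hz, zpow_zero]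

/-- The parametrisation of the affine cone over the Veronese, scaled by the sample size. -/
noncomputable def verMap (u : VerIndex d k → ℂ) (x : Option (Fin (d - 1)) → ℂ)
    (α : VerIndex d k) : ℂ :=
  (∑ β, u β)⁻¹ * ∏ j, x j ^ verExp α j

theorem verMap_mem_mlSolutions_iff (hk : 1 ≤ k) {u : VerIndex d k → ℂ} (hu : ∑ α, u α ≠ 0)
    {x : Option (Fin (d - 1)) → ℂ} (hx : ∀ i, x i ≠ 0) :
    verMap u x ∈ mlSolutions (verA d k) (fun _ => 1) u ↔
      ∀ i, MvPolynomial.eval x (verForm d k i) = verData u i := by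
  have hk0 : (k : ℂ) ≠ 0 := by exact_mod_cast (by omega : k ≠ 0)
  have hp : ∀ α, verMap u x α ≠ 0 := fun α =>
    mul_ne_zero (inv_ne_zero hu) (Finset.prod_ne_zero_iff.mpr fun j _ => pow_ne_zero _ (hx j))
  have hsum : (∑ α, u α) * ∑ α, verMap u x α = ∑ α : VerIndex d k, ∏ j, x j ^ verExp α j := by
    simp only [verMap]
    rw [← Finset.mul_sum, mul_inv_cancel_left₀ hu]
  have hA : ∀ i, (∑ α, u α) * ∑ α : VerIndex d k, (verA d k i α : ℂ) * verMap u x α =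
      verData (fun α : VerIndex d k => ∏ j, x j ^ verExp α j) (some i) := by
    intro i
    rw [verData, Finset.mul_sum]
    refine Finset.sum_congr rfl fun α _ => ?_
    rw [verMap, mul_left_comm, mul_inv_cancel_left₀ hu]
    simp [verA, verExp]
  have hA' : ∀ i, ∑ α : VerIndex d k, (verA d k i α : ℂ) * u α = verData u (some i) := by
    intro i
    simp [verData, verA, verExp]
  simp only [eval_verForm_eq_verData, mlSolutions, Set.mem_ofPred_eq, one_mul, hA, hA']
  constructor
  · rintro ⟨-, -, h1, h2⟩ (_ | i)
    · rw [verData_none, verData_none, ← hsum, h1, mul_one]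
      simp only [h2]
    · exact h2 i
  · intro h
    refine ⟨hp, fun v hv hv1 => ?_, ?_, fun i => h (some i)⟩
    · rw [prod_pow_toNat_eq_iff_prod_zpow_eq_one hp]
      exact prod_prod_pow_verExp_zpow hx (inv_ne_zero hu) hv hv1
    · have h1 := sum_verData u
      rw [← Finset.sum_congr rfl fun i _ => h i, sum_verData, ← hsum] at h1
      exact mul_left_cancel₀ (mul_ne_zero hk0 hu) (by rw [mul_assoc, h1, mul_one])

theorem ne_zero_of_eval_verForm_ne_zero {x : Option (Fin (d - 1)) → ℂ} {i : Option (Fin (d - 1))}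
    (h : MvPolynomial.eval x (verForm d k i) ≠ 0) : x i ≠ 0 := by
  intro hx
  refine h ?_
  rw [eval_verForm]
  refine Finset.sum_eq_zero fun α _ => ?_
  rcases eq_or_ne (verExp α i) 0 with h0 | h0
  · simp [h0]
  · rw [Finset.prod_eq_zero (Finset.mem_univ i) (by rw [hx, zero_pow h0]), mul_zero]

theorem prod_div_pow_mul_eq_of_binomial {p : VerIndex d k → ℂ} (hp : ∀ α, p α ≠ 0)
    (hbin : ∀ v : VerIndex d k → ℤ, (∀ i, ∑ α, verA d k i α * v α = 0) → ∑ α, v α = 0 →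
      ∏ α, p α ^ v α = 1)
    {a : VerIndex d k} (ha : ∀ i, verA d k i a = 0) {e : Fin (d - 1) → VerIndex d k}
    (he : ∀ i j, verA d k i (e j) = if i = j then 1 else 0) (α : VerIndex d k) :
    (∏ i, (p (e i) / p a) ^ (α.1 i : ℕ)) * p a = p α := by
  set S : ℤ := ∑ i, ((α.1 i : ℕ) : ℤ) with hS
  have hsum : ∀ f : VerIndex d k → ℤ, ∑ β, f β * ((1 : ℤ) * (Pi.single α 1 : VerIndex d k → ℤ) β +
      (S - 1) * (Pi.single a 1 : VerIndex d k → ℤ) β -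
        ∑ i, ((α.1 i : ℕ) : ℤ) * (Pi.single (e i) 1 : VerIndex d k → ℤ) β) =
      f α + (S - 1) * f a - ∑ i, ((α.1 i : ℕ) : ℤ) * f (e i) := by
    intro f
    simp only [mul_add, mul_sub, Finset.sum_add_distrib, Finset.sum_sub_distrib, Finset.mul_sum]
    rw [Finset.sum_comm]
    simp [Pi.single_apply, mul_comm]
  have hprod : ∀ (γ : VerIndex d k) (n : ℤ),
      ∏ β, p β ^ (n * (Pi.single γ 1 : VerIndex d k → ℤ) β) = p γ ^ n := by
    intro γ n
    rw [Finset.prod_eq_single γ (fun β _ hβ => by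
      rw [Pi.single_eq_of_ne hβ, mul_zero, zpow_zero]) (by simp), Pi.single_eq_same, mul_one]
  have h := hbin (fun β => (1 : ℤ) * (Pi.single α 1 : VerIndex d k → ℤ) β +
      (S - 1) * (Pi.single a 1 : VerIndex d k → ℤ) β -
        ∑ i, ((α.1 i : ℕ) : ℤ) * (Pi.single (e i) 1 : VerIndex d k → ℤ) β)
    (fun j => by
      rw [hsum, ha]
      simp only [he]
      simp [verA])
    (by
      have := hsum fun _ => 1
      simp only [one_mul, mul_one] at this ⊢
      rw [this, ← hS]
      ring)
  have hsplit : ∀ β, p β ^ ((1 : ℤ) * (Pi.single α 1 : VerIndex d k → ℤ) β +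
      (S - 1) * (Pi.single a 1 : VerIndex d k → ℤ) β -
        ∑ i, ((α.1 i : ℕ) : ℤ) * (Pi.single (e i) 1 : VerIndex d k → ℤ) β) =
      p β ^ ((1 : ℤ) * (Pi.single α 1 : VerIndex d k → ℤ) β) *
      p β ^ ((S - 1) * (Pi.single a 1 : VerIndex d k → ℤ) β) /
      ∏ i, p β ^ (((α.1 i : ℕ) : ℤ) * (Pi.single (e i) 1 : VerIndex d k → ℤ) β) := by
    intro β
    rw [zpow_sub₀ (hp β), zpow_add₀ (hp β), Finset.prod_zpow_eq_zpow_sum₀ (hp β)]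
  simp only [hsplit] at h
  rw [Finset.prod_div_distrib, Finset.prod_mul_distrib, Finset.prod_comm] at h
  simp only [hprod, zpow_one, zpow_natCast] at h
  rw [div_eq_one_iff_eq (Finset.prod_ne_zero_iff.mpr fun i _ => pow_ne_zero _ (hp _))] at h
  simp only [div_pow, Finset.prod_div_distrib, Finset.prod_pow_eq_pow_sum]
  rw [← h, zpow_sub₀ (hp a), zpow_one, hS, ← Nat.cast_sum, zpow_natCast]
  have := hp a
  field_simp

theorem exists_verMap_eq (hk : 1 ≤ k) {u p : VerIndex d k → ℂ} (hu : ∑ α, u α ≠ 0)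
    (hp : p ∈ mlSolutions (verA d k) (fun _ => 1) u) :
    ∃ x : Option (Fin (d - 1)) → ℂ, (∀ i, x i ≠ 0) ∧ verMap u x = p := by
  obtain ⟨hp0, hbin, -, -⟩ := hp
  obtain ⟨a, ha⟩ := exists_verExp_eq (d := d) (k := k) (β := Pi.single none k) (by simp)
  have hex : ∀ i : Fin (d - 1), ∃ e : VerIndex d k,
      verExp e = Pi.single none (k - 1) + Pi.single (some i) 1 := fun i =>
    exists_verExp_eq (by simp [Finset.sum_add_distrib]; omega)
  choose e he using hex
  obtain ⟨t, ht⟩ := IsAlgClosed.exists_pow_nat_eq ((∑ α, u α) * p a) hk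
  have ht0 : t ≠ 0 := by
    rintro rfl
    rw [zero_pow (by omega)] at ht
    exact mul_ne_zero hu (hp0 a) ht.symm
  refine ⟨fun i => i.elim t fun i => t * (p (e i) / p a), ?_, ?_⟩
  · rintro (_ | i)
    · exact ht0
    · exact mul_ne_zero ht0 (div_ne_zero (hp0 _) (hp0 _))
  funext α
  have hα := prod_div_pow_mul_eq_of_binomial hp0
    (fun v hv hv1 => (prod_pow_toNat_eq_iff_prod_zpow_eq_one hp0 v).mp (hbin v hv hv1))
    (a := a) (e := e)
    (fun i => by simpa [verExp, verA] using congrFun ha (some i))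
    (fun i j => by
      have := congrFun (he j) (some i)
      simp only [verExp, Option.elim, Pi.add_apply, Pi.single_apply, Option.some.injEq,
        reduceCtorEq, if_false, zero_add] at this
      simp only [verA, this]
      split_ifs <;> rfl) α
  rw [verMap, Fintype.prod_option]
  simp only [Option.elim, mul_pow, Finset.prod_mul_distrib, Finset.prod_pow_eq_pow_sum]
  rw [← hα, ← mul_assoc (t ^ _), ← pow_add]
  have : verExp α none + ∑ i, verExp α (some i) = k := by rw [← Fintype.sum_option, sum_verExp]
  rw [this, ht, mul_assoc, inv_mul_cancel_left₀ hu, mul_comm]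
  rfl

theorem verMap_eq_verMap_iff (hk : 1 ≤ k) {u : VerIndex d k → ℂ} (hu : ∑ α, u α ≠ 0)
    {x y : Option (Fin (d - 1)) → ℂ} (hx : ∀ i, x i ≠ 0) (hy : ∀ i, y i ≠ 0) :
    verMap u y = verMap u x ↔ ∃ ζ : ℂ, ζ ^ k = 1 ∧ y = ζ • x := by
  constructor
  · intro h
    have h' : ∀ α : VerIndex d k, ∏ j, y j ^ verExp α j = ∏ j, x j ^ verExp α j := fun α =>
      mul_left_cancel₀ (inv_ne_zero hu) (congrFun h α)
    have hs : ∀ (i : Option (Fin (d - 1))) (n : ℕ) (z : Option (Fin (d - 1)) → ℂ),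
        ∏ j, z j ^ (Pi.single i n : Option (Fin (d - 1)) → ℕ) j = z i ^ n := by
      intro i n z
      rw [Finset.prod_eq_single i (fun j _ hj => by rw [Pi.single_eq_of_ne hj, pow_zero])
        (by simp), Pi.single_eq_same]
    have hnone : y none ^ k = x none ^ k := by
      obtain ⟨a, ha⟩ := exists_verExp_eq (d := d) (k := k) (β := Pi.single none k) (by simp)
      simpa [ha, hs] using h' a
    have hsome : ∀ i, y none ^ (k - 1) * y i = x none ^ (k - 1) * x i := by
      intro i
      obtain ⟨a, ha⟩ := exists_verExp_eq (d := d) (k := k)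
        (β := Pi.single none (k - 1) + Pi.single i 1) (by simp [Finset.sum_add_distrib]; omega)
      simpa [ha, pow_add, Finset.prod_mul_distrib, hs] using h' a
    refine ⟨y none / x none, ?_, ?_⟩
    · rw [div_pow, hnone, div_self (pow_ne_zero _ (hx _))]
    · funext i
      have h1 : y none ^ (k - 1) * y none = x none ^ (k - 1) * x none := hsome none
      refine mul_left_cancel₀ (pow_ne_zero (k - 1) (hy none)) ?_
      rw [hsome i, Pi.smul_apply, smul_eq_mul]
      have := hx none
      field_simp
      linear_combination (-(x i)) * h1
  · rintro ⟨ζ, hζ, rfl⟩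
    funext α
    simp only [verMap, Pi.smul_apply, smul_eq_mul, mul_pow, Finset.prod_mul_distrib,
      Finset.prod_pow_eq_pow_sum, sum_verExp, hζ, one_mul]

theorem ncard_smul_roots_of_unity (hk : 1 ≤ k) {σ : Type*} {x : σ → ℂ} (hx : x ≠ 0) :
    {y : σ → ℂ | ∃ ζ : ℂ, ζ ^ k = 1 ∧ y = ζ • x}.ncard = k := by
  have hset : {y : σ → ℂ | ∃ ζ : ℂ, ζ ^ k = 1 ∧ y = ζ • x} =
      (fun ζ : ℂ => ζ • x) '' (Polynomial.nthRootsFinset k (1 : ℂ)) := by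
    ext y
    simp [Polynomial.mem_nthRootsFinset hk, eq_comm]
  rw [hset, Set.ncard_image_of_injective _ (smul_left_injective ℂ hx), Set.ncard_coe_finset]
  exact (Complex.isPrimitiveRoot_exp k (by omega)).card_nthRootsFinset

theorem verData_surjective (hk : 1 ≤ k) :
    Function.Surjective (verData : (VerIndex d k → ℂ) → Option (Fin (d - 1)) → ℂ) := by
  intro y
  have hk0 : (k : ℂ) ≠ 0 := by exact_mod_cast (by omega : k ≠ 0)
  have hex : ∀ i : Option (Fin (d - 1)), ∃ e : VerIndex d k, verExp e = Pi.single i k := fun i =>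
    exists_verExp_eq (by simp)
  choose e he using hex
  refine ⟨∑ i, Pi.single (e i) (y i / k), ?_⟩
  funext j
  simp only [verData, Finset.sum_apply, Finset.mul_sum]
  rw [Finset.sum_comm]
  simp only [Pi.single_apply, mul_ite, mul_zero, Finset.sum_ite_eq', Finset.mem_univ, if_true, he]
  simp [hk0, mul_div_cancel₀]

theorem ncard_eq_mul_ncard_mlSolutions (hk : 1 ≤ k) {u : VerIndex d k → ℂ}
    (hu : ∑ α, u α ≠ 0) (hy : ∀ i, verData u i ≠ 0)
    (hfin : {x | ∀ i, MvPolynomial.eval x (verForm d k i) = verData u i}.Finite) :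
    (mlSolutions (verA d k) (fun _ => 1) u).Finite ∧
      {x | ∀ i, MvPolynomial.eval x (verForm d k i) = verData u i}.ncard =
        k * (mlSolutions (verA d k) (fun _ => 1) u).ncard := by
  set S := {x | ∀ i, MvPolynomial.eval x (verForm d k i) = verData u i} with hS
  have hne : ∀ x ∈ S, ∀ i, x i ≠ 0 := fun x hx i =>
    ne_zero_of_eval_verForm_ne_zero (by rw [hx i]; exact hy i)
  have himage : verMap u '' S = mlSolutions (verA d k) (fun _ => 1) u := by
    ext p
    constructor
    · rintro ⟨x, hx, rfl⟩
      exact (verMap_mem_mlSolutions_iff hk hu (hne x hx)).mpr hx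
    · intro hp
      obtain ⟨x, hx, rfl⟩ := exists_verMap_eq hk hu hp
      exact ⟨x, (verMap_mem_mlSolutions_iff hk hu hx).mp hp, rfl⟩
  refine ⟨himage ▸ hfin.image _, hfin.ncard_eq_mul_of_ncard_fiber himage fun p hp => ?_⟩
  obtain ⟨x, hx, rfl⟩ := exists_verMap_eq hk hu hp
  refine Eq.trans ?_ (ncard_smul_roots_of_unity hk (x := x)
    fun h => hx none (congrFun h none))
  congr 1
  ext y
  constructor
  · rintro ⟨hyS, hyx⟩
    exact (verMap_eq_verMap_iff hk hu hx (hne y hyS)).mp hyx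
  · rintro ⟨ζ, hζ, rfl⟩
    have hζ0 : ζ ≠ 0 := by
      rintro rfl
      rw [zero_pow (by omega)] at hζ
      exact zero_ne_one hζ
    have hy0 : ∀ i, (ζ • x) i ≠ 0 := fun i => mul_ne_zero hζ0 (hx i)
    have heq := (verMap_eq_verMap_iff hk hu hx hy0).mpr ⟨ζ, hζ, rfl⟩
    exact ⟨(verMap_mem_mlSolutions_iff hk hu hy0).mp (heq ▸ hp), heq⟩

/-- A nonzero polynomial in the sufficient statistics pulls back to a nonzero polynomial in the
data. -/
theorem exists_eval_eq_eval_verData (hk : 1 ≤ k)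
    {P : MvPolynomial (Option (Fin (d - 1))) ℂ} (hP : P ≠ 0) :
    ∃ G : MvPolynomial (VerIndex d k) ℂ, G ≠ 0 ∧
      ∀ u, MvPolynomial.eval u G = MvPolynomial.eval (verData u) P := by
  have heval : ∀ u, MvPolynomial.eval u (MvPolynomial.bind₁ (fun i => ∑ α : VerIndex d k,
      MvPolynomial.C (verExp α i : ℂ) * MvPolynomial.X α) P) =
      MvPolynomial.eval (verData u) P := by
    intro u
    rw [← MvPolynomial.coe_aeval_eq_eval, RingHom.coe_coe, MvPolynomial.aeval_bind₁,
      ← MvPolynomial.coe_aeval_eq_eval, RingHom.coe_coe]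
    congr 2
    funext i
    simp [verData]
  refine ⟨_, fun h => hP (MvPolynomial.funext fun y => ?_), heval⟩
  obtain ⟨u, rfl⟩ := verData_surjective hk y
  rw [← heval u, h, map_zero, map_zero]

end Veronese

/-- For `k ≤ d - 1`, the ML degree of the Veronese `Ver(d-1,k)` with trivial scaling
`c = (1,…,1)` equals its degree `k^(d-1)`. -/
theorem ml_degree_veronese (d k : ℕ) (hd : 2 ≤ d) (hk : 1 ≤ k) (hkd : k ≤ d - 1) :
    ∃ G : MvPolynomial (VerIndex d k) ℂ, G ≠ 0 ∧
      ∀ u : VerIndex d k → ℂ, MvPolynomial.eval u G ≠ 0 →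
        (mlSolutions (verA d k) (fun _ => 1) u).Finite ∧
        (mlSolutions (verA d k) (fun _ => 1) u).ncard = k ^ (d - 1) := by
  obtain ⟨P, hP, hcount⟩ := exists_generic_ncard_fiber_eq_pow rfl
    (isHomogeneous_verForm (d := d) (k := k)) hk fun _ => eq_zero_of_eval_verForm_eq_zero hk
  have hsum : (∑ i, MvPolynomial.X i : MvPolynomial (Option (Fin (d - 1))) ℂ) ≠ 0 := by
    intro h
    simpa using congrArg (MvPolynomial.eval (Pi.single none 1)) h
  have hprod : (∏ i, MvPolynomial.X i : MvPolynomial (Option (Fin (d - 1))) ℂ) ≠ 0 :=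
    Finset.prod_ne_zero_iff.mpr fun i _ => MvPolynomial.X_ne_zero i
  obtain ⟨G, hG, heval⟩ := exists_eval_eq_eval_verData hk (mul_ne_zero (mul_ne_zero hP hprod) hsum)
  refine ⟨G, hG, fun u hu => ?_⟩
  simp only [heval, map_mul, map_prod, map_sum, MvPolynomial.eval_X, sum_verData, mul_ne_zero_iff,
    Finset.prod_ne_zero_iff, Finset.mem_univ, true_imp_iff] at hu
  obtain ⟨⟨hPu, hy⟩, -, hu⟩ := hu
  obtain ⟨hfin, hcard⟩ := hcount _ hPu
  obtain ⟨hfin', hmul⟩ := ncard_eq_mul_ncard_mlSolutions hk hu hy hfin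
  refine ⟨hfin', Nat.eq_of_mul_eq_mul_left hk ?_⟩
  rw [← hmul, hcard, Fintype.card_option, Fintype.card_fin, pow_succ']
end

section
/- Let d ≥ 2 and 1 ≤ k ≤ d−1, and let f ∈ ℂ[θ_1,…,θ_{d−1}] be the sum of all monomials of total degree at most k, i.e. f = Σ_{α ∈ ℕ^{d−1}, α_1+⋯+α_{d−1} ≤ k} θ^α = 1 + h_1 + h_2 + ⋯ + h_k, where h_i is the i-th complete homogeneous symmetric polynomial in θ_1,…,θ_{d−1}. Then f has no singular zero in the torus: there is no θ ∈ (ℂ*)^{d−1} with f(θ) = 0 and (∂f/∂θ_i)(θ) = 0 for all i = 1,…,d−1. -/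
open scoped BigOperators

/-- The sum of all monomials of total degree at most `k` in `θ₁,…,θ_{d-1}`,
i.e. `f = 1 + h₁ + ⋯ + h_k` with `h_i` the complete homogeneous symmetric
polynomials. -/
noncomputable def verF (d k : ℕ) : MvPolynomial (Fin (d - 1)) ℂ :=
  ∑ α : VerIndex d k, ∏ i, MvPolynomial.X i ^ ((α.1 i : ℕ))

/-- The exponent vectors on `n` variables of total degree at most `k`. -/
def exponentsLE (n k : ℕ) : Finset (Fin n → ℕ) :=
  (Fintype.piFinset fun _ => Finset.range (k + 1)).filter fun α => ∑ i, α i ≤ k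

theorem mem_exponentsLE {n k : ℕ} {α : Fin n → ℕ} :
    α ∈ exponentsLE n k ↔ ∑ i, α i ≤ k := by
  simp only [exponentsLE, Finset.mem_filter, Fintype.mem_piFinset, Finset.mem_range,
    and_iff_right_iff_imp]
  intro h i
  have := Finset.single_le_sum (fun j _ => Nat.zero_le (α j)) (Finset.mem_univ i)
  omega

/-- Multiplying by `x i` shifts the `i`-th Euler derivative of the sum of all monomials of
degree at most `k` up by one degree. -/
theorem sum_exponentsLE_succ_mul {n : ℕ} (x : Fin n → ℂ) (k : ℕ) (i : Fin n) :
    ∑ α ∈ exponentsLE n (k + 1), (α i : ℂ) * ∏ j, x j ^ α j =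
      x i * ∑ α ∈ exponentsLE n k, ((α i : ℂ) + 1) * ∏ j, x j ^ α j := by
  have hsub : (exponentsLE n k).map (addRightEmbedding (Pi.single i 1)) ⊆
      exponentsLE n (k + 1) := by
    intro α hα
    obtain ⟨β, hβ, rfl⟩ := Finset.mem_map.1 hα
    rw [mem_exponentsLE] at hβ ⊢
    simp [Finset.sum_add_distrib, hβ]
  rw [← Finset.sum_subset hsub, Finset.sum_map, Finset.mul_sum]
  · refine Finset.sum_congr rfl fun β _ => ?_
    have h : ∏ j, x j ^ (Pi.single i 1 : Fin n → ℕ) j = x i := by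
      simp [Pi.single_apply, pow_ite, Finset.prod_ite_eq']
    simp only [addRightEmbedding_apply, Pi.add_apply, pow_add, Finset.prod_mul_distrib, h,
      Pi.single_eq_same, Nat.cast_add, Nat.cast_one]
    ring
  · intro α hα hα'
    have h0 : α i = 0 := by
      by_contra h0
      have hle : Pi.single i 1 ≤ α := by
        intro j
        by_cases hj : j = i
        · subst hj
          simpa using Nat.one_le_iff_ne_zero.2 h0
        · simp [hj]
      refine hα' (Finset.mem_map.2 ⟨α - Pi.single i 1, ?_, tsub_add_cancel_of_le hle⟩)
      rw [mem_exponentsLE] at hα ⊢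
      have h := congrArg (fun β : Fin n → ℕ => ∑ j, β j) (tsub_add_cancel_of_le hle)
      simp only [Pi.add_apply, Finset.sum_add_distrib, Finset.sum_pi_single',
        Finset.mem_univ, if_true] at h
      omega
    simp [h0]

/-- The Euler derivative in the homogenizing variable shifts by one degree. -/
theorem sum_exponentsLE_succ_codegree {n : ℕ} (x : Fin n → ℂ) (k : ℕ) :
    ∑ α ∈ exponentsLE n (k + 1), ((k + 1 : ℂ) - ∑ i, (α i : ℂ)) * ∏ j, x j ^ α j =
      ∑ α ∈ exponentsLE n k, ((k + 1 : ℂ) - ∑ i, (α i : ℂ)) * ∏ j, x j ^ α j := by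
  symm
  apply Finset.sum_subset
  · intro α hα
    rw [mem_exponentsLE] at hα ⊢
    omega
  · intro α hα hα'
    rw [mem_exponentsLE] at hα hα'
    have h : ∑ i, α i = k + 1 := by omega
    have h' : ∑ i, (α i : ℂ) = k + 1 := by exact_mod_cast h
    simp [h']

theorem sum_exponentsLE_not_singular {n : ℕ} (x : Fin n → ℂ) (hx : ∀ i, x i ≠ 0) (k : ℕ)
    (h : ∑ α ∈ exponentsLE n k, ∏ j, x j ^ α j = 0)
    (hd : ∀ i, ∑ α ∈ exponentsLE n k, (α i : ℂ) * ∏ j, x j ^ α j = 0) : False := by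
  induction k with
  | zero =>
    have h0 : exponentsLE n 0 = {0} := by
      ext α
      simp [mem_exponentsLE, funext_iff]
    simp [h0] at h
  | succ k ih =>
    have euler (l : ℕ) (c : ℂ) :
        ∑ α ∈ exponentsLE n l, (c - ∑ i, (α i : ℂ)) * ∏ j, x j ^ α j =
          c * ∑ α ∈ exponentsLE n l, ∏ j, x j ^ α j -
            ∑ i, ∑ α ∈ exponentsLE n l, (α i : ℂ) * ∏ j, x j ^ α j := by
      rw [Finset.sum_comm, Finset.mul_sum, ← Finset.sum_sub_distrib]
      exact Finset.sum_congr rfl fun α _ => by rw [sub_mul, Finset.sum_mul]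
    have hi (i : Fin n) : ∑ α ∈ exponentsLE n k, (α i : ℂ) * ∏ j, x j ^ α j =
        -∑ α ∈ exponentsLE n k, ∏ j, x j ^ α j := by
      have h1 := hd i
      rw [sum_exponentsLE_succ_mul, mul_eq_zero, or_iff_right (hx i)] at h1
      simp only [add_mul, one_mul, Finset.sum_add_distrib] at h1
      exact eq_neg_of_add_eq_zero_left h1
    have h0 := sum_exponentsLE_succ_codegree x k
    rw [euler, euler, h, Finset.sum_congr rfl fun i _ => hd i,
      Finset.sum_congr rfl fun i _ => hi i] at h0
    have hS : ∑ α ∈ exponentsLE n k, ∏ j, x j ^ α j = 0 := by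
      have h2 : ((k + 1 + n : ℕ) : ℂ) * ∑ α ∈ exponentsLE n k, ∏ j, x j ^ α j = 0 := by
        simp only [mul_zero, Finset.sum_const_zero, sub_zero, Finset.sum_const,
          Finset.card_univ, Fintype.card_fin, nsmul_eq_mul] at h0
        push_cast
        linear_combination -h0
      exact (mul_eq_zero.1 h2).resolve_left (Nat.cast_ne_zero.2 (by omega))
    exact ih hS fun i => by rw [hi, hS, neg_zero]

theorem verF_eq_sum_monomial (d k : ℕ) :
    verF d k = ∑ α ∈ exponentsLE (d - 1) k,
      MvPolynomial.monomial (Finsupp.equivFunOnFinite.symm α) 1 := by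
  refine Finset.sum_bij (fun α _ i => (α.1 i : ℕ)) ?_ ?_ ?_ ?_
  · intro α _
    exact mem_exponentsLE.2 α.2
  · intro α _ β _ hαβ
    exact Subtype.ext (funext fun i => Fin.ext (congrFun hαβ i))
  · intro α hα
    have hα' := hα
    rw [exponentsLE, Finset.mem_filter, Fintype.mem_piFinset] at hα'
    exact ⟨⟨fun i => ⟨α i, Finset.mem_range.1 (hα'.1 i)⟩, hα'.2⟩, Finset.mem_univ _, rfl⟩
  · intro α _
    rw [MvPolynomial.monomial_eq, Finsupp.prod_fintype _ _ (by simp)]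
    simp

/-- For `1 ≤ k ≤ d - 1`, the sum `f` of all monomials of degree at most `k` has no
singular zero in the torus: there is no `θ ∈ (ℂ*)^{d-1}` with `f(θ) = 0` and
`(∂f/∂θᵢ)(θ) = 0` for all `i`.  (The trivial scaling is not on the `A`-discriminant
of the Veronese `Ver(d-1,k)`.) -/
theorem veronese_no_singular_torus_zero (d k : ℕ) (hd : 2 ≤ d) (hk : 1 ≤ k)
    (hkd : k ≤ d - 1) :
    ¬ ∃ θ : Fin (d - 1) → ℂ, (∀ i, θ i ≠ 0) ∧
        MvPolynomial.eval θ (verF d k) = 0 ∧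
        ∀ i, MvPolynomial.eval θ (MvPolynomial.pderiv i (verF d k)) = 0 := by
  rintro ⟨θ, hθ, h, hd'⟩
  have eval_monomial (α : Fin (d - 1) → ℕ) :
      MvPolynomial.eval θ (MvPolynomial.monomial (Finsupp.equivFunOnFinite.symm α) 1) =
        ∏ j, θ j ^ α j := by
    rw [MvPolynomial.eval_monomial, Finsupp.prod_fintype _ _ (by simp)]
    simp
  refine sum_exponentsLE_not_singular θ hθ k ?_ fun i => ?_
  · simpa only [verF_eq_sum_monomial, map_sum, eval_monomial] using h
  · have h1 : MvPolynomial.eval θ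
        (MvPolynomial.X i * MvPolynomial.pderiv i (verF d k)) = 0 := by
      rw [map_mul, hd' i, mul_zero]
    simpa only [verF_eq_sum_monomial, map_sum, Finset.mul_sum,
      MvPolynomial.X_mul_pderiv_monomial, nsmul_eq_mul, map_mul, map_natCast, eval_monomial,
      Finsupp.equivFunOnFinite_symm_apply_apply] using h1
end

section
/- Let d ≥ 2 and 1 ≤ k ≤ d−1, and let f = e_{k−1} + e_k ∈ ℂ[θ_1,…,θ_{d−1}], where e_j denotes the j-th elementary symmetric polynomial in θ_1,…,θ_{d−1} (with e_0 = 1). Then f has no singular zero in the torus: there is no θ ∈ (ℂ*)^{d−1} with f(θ) = 0 and (∂f/∂θ_i)(θ) = 0 for all i = 1,…,d−1. -/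
open scoped BigOperators

namespace MvPolynomial

variable {σ R : Type*} [Fintype σ] [CommRing R]

/-- The elementary symmetric polynomial in the variables other than `i`. -/
noncomputable def esymmErase [DecidableEq σ] (R : Type*) [CommRing R] (i : σ) (j : ℕ) :
    MvPolynomial σ R :=
  ∑ t ∈ (Finset.univ.erase i).powersetCard j, ∏ l ∈ t, X l

theorem esymm_succ_eq_esymmErase [DecidableEq σ] (i : σ) (j : ℕ) :
    esymm σ R (j + 1) = esymmErase R i (j + 1) + X i * esymmErase R i j := by
  have hi : i ∉ Finset.univ.erase i := Finset.notMem_erase i _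
  have hmem : ∀ t ∈ (Finset.univ.erase i).powersetCard j, i ∉ t := fun t ht hit =>
    hi ((Finset.mem_powersetCard.mp ht).1 hit)
  have hdisj : Disjoint ((Finset.univ.erase i).powersetCard (j + 1))
      (((Finset.univ.erase i).powersetCard j).image (insert i)) := by
    rw [Finset.disjoint_left]
    intro t ht ht'
    obtain ⟨u, -, rfl⟩ := Finset.mem_image.mp ht'
    exact hi ((Finset.mem_powersetCard.mp ht).1 (Finset.mem_insert_self i u))
  rw [esymm, ← Finset.insert_erase (Finset.mem_univ i), Finset.powersetCard_succ_insert hi,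
    Finset.sum_union hdisj, Finset.sum_image, esymmErase, esymmErase, Finset.mul_sum]
  · congr 1
    exact Finset.sum_congr rfl fun t ht => Finset.prod_insert (hmem t ht)
  · intro s hs t ht hst
    rw [← Finset.erase_insert (hmem s hs), ← Finset.erase_insert (hmem t ht)]
    exact congrArg (fun u => u.erase i) hst

theorem pderiv_esymmErase [DecidableEq σ] (i : σ) (j : ℕ) :
    pderiv i (esymmErase R i j) = 0 := by
  rw [esymmErase, map_sum]
  refine Finset.sum_eq_zero fun t ht => ?_
  refine Finset.prod_induction _ (fun q => pderiv i q = 0) (fun p q hp hq => ?_)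
    (pderiv i).map_one_eq_zero fun l hl =>
      pderiv_X_of_ne (Finset.ne_of_mem_erase ((Finset.mem_powersetCard.mp ht).1 hl))
  rw [Derivation.leibniz, hp, hq, smul_zero, smul_zero, add_zero]

theorem pderiv_esymm_succ_eq_esymmErase [DecidableEq σ] (i : σ) (j : ℕ) :
    pderiv i (esymm σ R (j + 1)) = esymmErase R i j := by
  simp [esymm_succ_eq_esymmErase i j, pderiv_esymmErase]

theorem pderiv_esymm_succ_add (i : σ) (j : ℕ) :
    pderiv i (esymm σ R (j + 1)) + X i * pderiv i (esymm σ R j) = esymm σ R j := by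
  classical
  cases j with
  | zero => simp
  | succ j =>
    rw [pderiv_esymm_succ_eq_esymmErase, pderiv_esymm_succ_eq_esymmErase,
      esymm_succ_eq_esymmErase i j]

theorem isHomogeneous_esymm (j : ℕ) : (esymm σ R j).IsHomogeneous j := by
  refine IsHomogeneous.sum _ _ _ fun t ht => ?_
  have := IsHomogeneous.prod t (fun l => (X l : MvPolynomial σ R)) (fun _ => 1)
    fun l _ => isHomogeneous_X R l
  simpa [(Finset.mem_powersetCard.mp ht).2] using this

theorem sum_X_mul_pderiv_esymm (j : ℕ) :
    ∑ i, X i * pderiv i (esymm σ R j) = j • esymm σ R j :=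
  (isHomogeneous_esymm j).sum_X_mul_pderiv

theorem sum_pderiv_esymm_succ (j : ℕ) :
    ∑ i, pderiv i (esymm σ R (j + 1)) =
      ((Fintype.card σ : MvPolynomial σ R) - j) * esymm σ R j := by
  have h : ∀ i, pderiv i (esymm σ R (j + 1)) =
      esymm σ R j - X i * pderiv i (esymm σ R j) := fun i =>
    eq_sub_of_add_eq (pderiv_esymm_succ_add i j)
  simp only [h, Finset.sum_sub_distrib, sum_X_mul_pderiv_esymm]
  simp [sub_mul]

/-- A torus point cannot be a singular zero of `e_j + e_{j+1}`. -/
theorem not_singular_zero_esymm_add_esymm_succ {K : Type*} [Field K] [CharZero K] (θ : σ → K)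
    (hθ : ∀ i, θ i ≠ 0) (j : ℕ) (hj : j < Fintype.card σ)
    (h0 : eval θ (esymm σ K j + esymm σ K (j + 1)) = 0)
    (h1 : ∀ i, eval θ (pderiv i (esymm σ K j + esymm σ K (j + 1))) = 0) : False := by
  simp only [map_add] at h0 h1
  induction j with
  | zero =>
    obtain ⟨i⟩ := Fintype.card_pos_iff.mp hj
    have h := congrArg (eval θ) (pderiv_esymm_succ_add (R := K) i 0)
    have hi := h1 i
    simp at h hi
    simp [h] at hi
  | succ j ih =>
    have euler (m : ℕ) : ∑ i, θ i * eval θ (pderiv i (esymm σ K m)) =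
        m * eval θ (esymm σ K m) := by
      simpa using congrArg (eval θ) (sum_X_mul_pderiv_esymm (σ := σ) (R := K) m)
    have total (m : ℕ) : ∑ i, eval θ (pderiv i (esymm σ K (m + 1))) =
        ((Fintype.card σ : K) - m) * eval θ (esymm σ K m) := by
      simpa using congrArg (eval θ) (sum_pderiv_esymm_succ (σ := σ) (R := K) m)
    have step (i : σ) (m : ℕ) : eval θ (pderiv i (esymm σ K (m + 1))) +
        θ i * eval θ (pderiv i (esymm σ K m)) = eval θ (esymm σ K m) := by
      simpa using congrArg (eval θ) (pderiv_esymm_succ_add (R := K) i m)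
    have hmid : eval θ (esymm σ K (j + 1)) = 0 := by
      have h : ∑ i, θ i * (eval θ (pderiv i (esymm σ K (j + 1))) +
          eval θ (pderiv i (esymm σ K (j + 1 + 1)))) = 0 :=
        Finset.sum_eq_zero fun i _ => by rw [h1 i, mul_zero]
      simp only [mul_add, Finset.sum_add_distrib, euler] at h
      push_cast at h
      linear_combination ((j : K) + 2) * h0 - h
    have hlow : eval θ (esymm σ K j) = 0 := by
      have h : ∑ i, (eval θ (pderiv i (esymm σ K (j + 1))) +
          eval θ (pderiv i (esymm σ K (j + 1 + 1)))) = 0 :=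
        Finset.sum_eq_zero fun i _ => h1 i
      rw [Finset.sum_add_distrib, total, total, hmid, mul_zero, add_zero] at h
      refine (mul_eq_zero.mp h).resolve_left (sub_ne_zero.mpr ?_)
      exact_mod_cast (show Fintype.card σ ≠ j by omega)
    refine ih (by omega) (by rw [hlow, hmid, add_zero]) fun i => ?_
    refine (mul_eq_zero.mp ?_).resolve_left (hθ i)
    linear_combination step i j + step i (j + 1) - h1 i + hlow + hmid

end MvPolynomial

/-- For `1 ≤ k ≤ d - 1`, the polynomial `f = e_{k-1} + e_k` (elementary symmetric
polynomials in `θ₁,…,θ_{d-1}`) has no singular zero in the torus: there is no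
`θ ∈ (ℂ*)^{d-1}` with `f(θ) = 0` and `(∂f/∂θᵢ)(θ) = 0` for all `i`.
(The trivial scaling is not on the `A`-discriminant of the hypersimplex toric
variety.) -/
theorem hypersimplex_no_singular_torus_zero (d k : ℕ) (hd : 2 ≤ d) (hk : 1 ≤ k)
    (hkd : k ≤ d - 1) :
    ¬ ∃ θ : Fin (d - 1) → ℂ, (∀ i, θ i ≠ 0) ∧
        MvPolynomial.eval θ
          (MvPolynomial.esymm (Fin (d - 1)) ℂ (k - 1) +
            MvPolynomial.esymm (Fin (d - 1)) ℂ k) = 0 ∧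
        ∀ i, MvPolynomial.eval θ
          (MvPolynomial.pderiv i
            (MvPolynomial.esymm (Fin (d - 1)) ℂ (k - 1) +
              MvPolynomial.esymm (Fin (d - 1)) ℂ k)) = 0 := by
  rintro ⟨θ, hθ, h0, h1⟩
  obtain ⟨j, rfl⟩ := Nat.exists_eq_add_of_le' hk
  exact MvPolynomial.not_singular_zero_esymm_add_esymm_succ θ hθ j
    (by rw [Fintype.card_fin]; omega) h0 h1
end
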